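/- There exist constants c > 0 and C > 0 such that for every real x ≥ 2 and every s ∈ ℂ with 0 < |s − 1| < 1/10, one has |∑_{n ≤ x} Λ(n)/n^s − x^{1−s}/(1−s) + (ζ'/ζ)(s)| ≤ C·x^{1−Re(s)}·exp(−c·√(log x)). -/

import Mathlib

section

open Complex Metric Set

/-- A logarithmic derivative estimate of Borel–Carathéodory type. -/
theorem norm_deriv_div_le_of_norm_le {f : ℂ → ℂ} {c z : ℂ} {M R : ℝ}
    (hf : DifferentiableOn ℂ f (ball c R)) (hne : ∀ w ∈ ball c R, f w ≠ 0) (hM : 0 ≤ M)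
    (hbound : ∀ w ∈ ball c R, ‖f w‖ ≤ Real.exp M * ‖f c‖) (hz : z ∈ ball c R) :
    ‖deriv f z / f z‖ ≤ 8 * M * R / (R - ‖z - c‖) ^ 2 := by
  have hzR : ‖z - c‖ < R := by simpa [dist_eq_norm] using hz
  have hR : 0 < R := (norm_nonneg _).trans_lt hzR
  have hc : c ∈ ball c R := mem_ball_self hR
  have hderiv : DifferentiableOn ℂ (fun w ↦ deriv f w / f w) (ball c R) :=
    (hf.deriv isOpen_ball).div hf hne
  obtain ⟨F₀, hF₀⟩ := hderiv.isExactOn_ball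
  set F : ℂ → ℂ := fun w ↦ F₀ w - F₀ c with hFdef
  have hF : ∀ w ∈ ball c R, HasDerivAt F (deriv f w / f w) w := fun w hw ↦
    (hF₀ w hw).sub_const _
  have hFc : F c = 0 := by simp [hFdef]
  have hexp : ∀ w ∈ ball c R, f w = f c * exp (F w) := by
    have hd : ∀ w ∈ ball c R, HasDerivAt (fun w ↦ f w * exp (-F w)) 0 w := by
      intro w hw
      have h1 := (hf.differentiableAt (isOpen_ball.mem_nhds hw)).hasDerivAt.mul (hF w hw).neg.cexp
      convert! h1 using 1
      have := hne w hw
      simp only [Pi.neg_apply]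
      field_simp
      ring
    intro w hw
    have h2 := (convex_ball c R).is_const_of_fderivWithin_eq_zero (𝕜 := ℂ)
      (f := fun w ↦ f w * exp (-F w))
      (fun w hw ↦ (hd w hw).differentiableAt.differentiableWithinAt)
      (fun w hw ↦ by
        rw [fderivWithin_of_isOpen isOpen_ball hw]
        ext
        simpa using (hd w hw).deriv) hw hc
    simp only [hFc, neg_zero, Complex.exp_zero, mul_one] at h2
    rw [← h2, mul_assoc, ← Complex.exp_add]
    simp
  have hre : ∀ w ∈ ball c R, (F w).re ≤ M := by
    intro w hw
    have h1 := hbound w hw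
    rw [hexp w hw, norm_mul, mul_comm, Complex.norm_exp] at h1
    exact Real.exp_le_exp.mp (le_of_mul_le_mul_right h1 (norm_pos_iff.mpr (hne c hc)))
  have key : ∀ M' > M, ‖deriv f z / f z‖ ≤ 8 * M' * R / (R - ‖z - c‖) ^ 2 := by
    intro M' hM'
    set d := (R - ‖z - c‖) / 2 with hd
    have hd0 : 0 < d := by linarith
    have hcb : ∀ w ∈ closedBall z d, ‖w - c‖ ≤ R - d := by
      intro w hw
      have : ‖w - z‖ ≤ d := by simpa [dist_eq_norm] using hw
      calc ‖w - c‖ = ‖(w - z) + (z - c)‖ := by ring_nf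
        _ ≤ _ := norm_add_le _ _
        _ ≤ R - d := by linarith
    have hsub : closedBall z d ⊆ ball c R := fun w hw ↦ by
      have := hcb w hw
      rw [mem_ball, dist_eq_norm]; linarith
    have hG : ∀ w ∈ sphere z d, ‖F w‖ ≤ 2 * M' * R / d := by
      intro w hw
      have hw' := hcb w (sphere_subset_closedBall hw)
      have h1 := borelCaratheodory_zero (f := fun u ↦ F (c + u)) (M := M') (R := R) (z := w - c)
        (hM.trans_lt hM') (fun u hu ↦ by
          have : c + u ∈ ball c R := by simpa [dist_eq_norm] using hu
          exact ((hF _ this).comp_const_add c u).differentiableAt.differentiableWithinAt)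
        (fun u hu ↦ by
          have : c + u ∈ ball c R := by simpa [dist_eq_norm] using hu
          exact (hre _ this).trans hM'.le) hR
        (by rw [mem_ball_zero_iff]; linarith) (by simp [hFc])
      simp only [add_sub_cancel] at h1
      refine h1.trans ?_
      have : (0:ℝ) ≤ M' := hM.trans hM'.le
      gcongr
      · linarith
      · linarith
    have h2 := norm_deriv_le_of_forall_mem_sphere_norm_le hd0
      (DifferentiableOn.diffContOnCl (f := F) (s := ball z d) (by
        rw [closure_ball _ hd0.ne']
        exact fun w hw ↦ (hF w (hsub hw)).differentiableAt.differentiableWithinAt)) hG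
    rw [(hF z hz).deriv] at h2
    refine h2.trans (le_of_eq ?_)
    have : R - ‖z - c‖ = 2 * d := by rw [hd]; ring
    rw [this]
    field_simp
    ring
  have hlim : Filter.Tendsto (fun M' : ℝ ↦ 8 * M' * R / (R - ‖z - c‖) ^ 2)
      (nhdsWithin M (Ioi M)) (nhds (8 * M * R / (R - ‖z - c‖) ^ 2)) := by
    apply Filter.Tendsto.mono_left _ nhdsWithin_le_nhds
    exact (by fun_prop : Continuous fun M' : ℝ ↦ 8 * M' * R / (R - ‖z - c‖) ^ 2).tendsto M
  exact ge_of_tendsto hlim (eventually_mem_nhdsWithin.mono fun M' h ↦ key M' h)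

/-- Dividing an entire function by a Blaschke factor of a disc centred at the origin. -/
theorem exists_blaschke_quotient {f : ℂ → ℂ} {ρ : ℂ} {B R : ℝ} (hR : 0 < R)
    (hf : Differentiable ℂ f) (h0 : f 0 ≠ 0) (hB : ∀ z, ‖z‖ ≤ R → ‖f z‖ ≤ B)
    (hρ : f ρ = 0) (hρR : ‖ρ‖ < R) :
    ∃ g : ℂ → ℂ, Differentiable ℂ g ∧ ‖g 0‖ = ‖f 0‖ * (R / ‖ρ‖) ∧
      (∀ z, ‖z‖ ≤ R → ‖g z‖ ≤ B) ∧ (∀ z, ‖z‖ ≤ R → g z = 0 → f z = 0) ∧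
      deriv f 0 / f 0 = deriv g 0 / g 0 - 1 / ρ + (starRingEnd ℂ) ρ / R ^ 2 := by
  have hρ0 : ρ ≠ 0 := by rintro rfl; exact h0 hρ
  have hRc : (R : ℂ) ≠ 0 := by exact_mod_cast hR.ne'
  set q : ℂ → ℂ := dslope f ρ with hq
  have hqd : Differentiable ℂ q := by
    rw [← differentiableOn_univ, hq, differentiableOn_dslope Filter.univ_mem]
    exact hf.differentiableOn
  have hqf : ∀ z, (z - ρ) * q z = f z := fun z ↦ by
    simpa [hρ] using sub_smul_dslope f ρ z
  set g : ℂ → ℂ := fun z ↦ q z * ((R ^ 2 - (starRingEnd ℂ) ρ * z) / R) with hg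
  have hgd : Differentiable ℂ g := by
    rw [hg]; fun_prop
  have hq0 : q 0 = -f 0 / ρ := by
    have := hqf 0
    field_simp
    rw [← this]; ring
  refine ⟨g, hgd, ?_, ?_, ?_, ?_⟩
  · simp only [hg, hq0, mul_zero, sub_zero, norm_mul, norm_div, norm_neg, norm_pow, norm_real,
      Real.norm_eq_abs, abs_of_pos hR]
    field_simp
  · have hfr : ∀ z ∈ frontier (ball (0 : ℂ) R), ‖g z‖ ≤ B := by
      intro z hz
      rw [frontier_ball _ hR.ne'] at hz
      have h1 := norm_canonicalFactor_eval_circle_eq_one (R := R) (w := ρ) (z := z)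
        (by simpa using hρR) hz
      have hzρ : z - ρ ≠ 0 := by
        intro h
        rw [sub_eq_zero] at h
        rw [h] at hz
        simp at hz
        linarith
      have h2 : g z = f z * canonicalFactor R ρ z := by
        rw [canonicalFactor_apply, ← hqf z, hg]
        field_simp
      rw [h2, norm_mul, h1, mul_one]
      exact hB z (by simpa using hz.le)
    intro z hz
    refine norm_le_of_forall_mem_frontier_norm_le isBounded_ball hgd.diffContOnCl hfr ?_
    rw [closure_ball _ hR.ne']
    simpa using hz
  · intro z hz hgz
    rw [hg] at hgz
    rcases mul_eq_zero.mp hgz with h | h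
    · rw [← hqf, h, mul_zero]
    · exfalso
      rw [div_eq_zero_iff] at h
      have h' : (R : ℂ) ^ 2 = (starRingEnd ℂ) ρ * z := by
        rcases h with h | h
        · exact sub_eq_zero.mp h
        · exact absurd h hRc
      have h3 := congrArg norm h'
      simp only [norm_pow, norm_real, Real.norm_eq_abs, abs_of_pos hR, norm_mul, norm_conj] at h3
      nlinarith [norm_nonneg ρ, norm_nonneg z]
  · have hA : HasDerivAt f (1 * q 0 + (0 - ρ) * deriv q 0) 0 := by
      have := ((hasDerivAt_id (0 : ℂ)).sub_const ρ).mul (hqd 0).hasDerivAt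
      refine this.congr_of_eventuallyEq (Filter.Eventually.of_forall fun z ↦ ?_)
      simp [← hqf z]
    have hC : HasDerivAt g (deriv q 0 * ((R ^ 2 - (starRingEnd ℂ) ρ * 0) / R)
        + q 0 * ((0 - (starRingEnd ℂ) ρ * 1) / R)) 0 := by
      exact (hqd 0).hasDerivAt.mul
        ((((hasDerivAt_id (0 : ℂ)).const_mul ((starRingEnd ℂ) ρ)).const_sub ((R : ℂ) ^ 2)).div_const _
          |>.congr_deriv (by simp))
    have hq00 : q 0 ≠ 0 := by rw [hq0]; simp [h0, hρ0]
    have hg0 : g 0 = q 0 * R := by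
      simp only [hg, mul_zero, sub_zero]; field_simp
    have hf0 : f 0 = -ρ * q 0 := by rw [← hqf 0]; ring
    rw [hA.deriv, hC.deriv, hg0, hf0]
    field_simp
    ring

theorem re_inv_sub_conj_div (ρ : ℂ) (R : ℝ) :
    (1 / ρ - (starRingEnd ℂ) ρ / R ^ 2).re = ρ.re * (1 / ‖ρ‖ ^ 2 - 1 / R ^ 2) := by
  have h1 : ((starRingEnd ℂ) ρ / (R : ℂ) ^ 2).re = ρ.re / R ^ 2 := by
    rw [← ofReal_pow, div_ofReal_re, conj_re]
  rw [sub_re, h1, one_div, inv_re, normSq_eq_norm_sq]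
  ring

theorem neg_re_logDeriv_le_aux (n : ℕ) : ∀ {f : ℂ → ℂ} {M R : ℝ}, 0 < R →
    Differentiable ℂ f → f 0 ≠ 0 → (∀ z, ‖z‖ ≤ R → ‖f z‖ ≤ Real.exp M * ‖f 0‖) →
    (∀ z, ‖z‖ ≤ R → f z = 0 → z.re ≤ 0) → Real.exp M < 2 ^ n →
    -(deriv f 0 / f 0).re ≤ 16 * M / R := by
  induction n with
  | zero =>
    intro f M R hR hf h0 hM hre hn
    have h1 := hM 0 (by simpa using hR.le)
    have h3 := norm_pos_iff.mpr h0
    rw [pow_zero] at hn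
    nlinarith
  | succ n ih =>
    intro f M R hR hf h0 hM hre hn
    have hf0 := norm_pos_iff.mpr h0
    have hM0 : 0 ≤ M := by
      have h1 := hM 0 (by simpa using hR.le)
      exact Real.one_le_exp_iff.mp (le_of_mul_le_mul_right (by linarith) hf0)
    by_cases hz : ∃ ρ, ‖ρ‖ < R / 2 ∧ f ρ = 0
    · obtain ⟨ρ, hρR, hρ⟩ := hz
      have hρ0 : 0 < ‖ρ‖ := norm_pos_iff.mpr (by rintro rfl; exact h0 hρ)
      obtain ⟨g, hg, hg0, hgB, hgz, hgd⟩ := exists_blaschke_quotient hR hf h0 hM hρ (by linarith)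
      have h2 : 2 ≤ R / ‖ρ‖ := by rw [le_div_iff₀ hρ0]; linarith
      have hg0' : 2 * ‖f 0‖ ≤ ‖g 0‖ := by rw [hg0]; nlinarith
      have hexp : Real.exp (M - Real.log 2) = Real.exp M / 2 := by
        rw [Real.exp_sub, Real.exp_log two_pos]
      have h3 := ih (f := g) (M := M - Real.log 2) hR hg (norm_pos_iff.mp (by linarith))
        (fun z hz ↦ (hgB z hz).trans (by
          rw [hexp]; nlinarith [Real.exp_pos M]))
        (fun z hz h ↦ hre z hz (hgz z hz h))
        (by rw [hexp]; rw [pow_succ] at hn; linarith)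
      have h4 := re_inv_sub_conj_div ρ R
      have h5 : ρ.re * (1 / ‖ρ‖ ^ 2 - 1 / R ^ 2) ≤ 0 := by
        refine mul_nonpos_of_nonpos_of_nonneg (hre ρ (by linarith) hρ) (sub_nonneg.mpr ?_)
        gcongr
        linarith
      have h6 : 16 * (M - Real.log 2) / R ≤ 16 * M / R := by
        gcongr
        linarith [Real.log_pos one_lt_two]
      rw [hgd]
      simp only [add_re, sub_re] at h4 ⊢
      linarith
    · push Not at hz
      have h1 := norm_deriv_div_le_of_norm_le (f := f) (c := 0) (z := 0) (R := R / 2) (M := M)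
        hf.differentiableOn (fun w hw ↦ hz w (by simpa using hw)) hM0
        (fun w hw ↦ hM w (by
          have : ‖w‖ < R / 2 := by simpa using hw
          linarith)) (mem_ball_self (by linarith))
      have h2 : -(deriv f 0 / f 0).re ≤ ‖deriv f 0 / f 0‖ :=
        (neg_le_abs _).trans (abs_re_le_norm _)
      refine (h2.trans h1).trans (le_of_eq ?_)
      simp
      field_simp
      ring

/-- The Landau lemma: an upper bound for the negative real part of a logarithmic derivative. -/
theorem neg_re_logDeriv_le {f : ℂ → ℂ} {M R : ℝ} (hR : 0 < R)
    (hf : Differentiable ℂ f) (h0 : f 0 ≠ 0)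
    (hM : ∀ z, ‖z‖ ≤ R → ‖f z‖ ≤ Real.exp M * ‖f 0‖)
    (hre : ∀ z, ‖z‖ ≤ R → f z = 0 → z.re ≤ 0) :
    -(deriv f 0 / f 0).re ≤ 16 * M / R := by
  obtain ⟨n, hn⟩ := pow_unbounded_of_one_lt (Real.exp M) one_lt_two
  exact neg_re_logDeriv_le_aux n hR hf h0 hM hre hn

/-- The Landau lemma, keeping the contribution of a real zero. -/
theorem neg_re_logDeriv_le_of_zero {f : ℂ → ℂ} {M R η : ℝ} (hR : 0 < R)
    (hf : Differentiable ℂ f) (h0 : f 0 ≠ 0)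
    (hM : ∀ z, ‖z‖ ≤ R → ‖f z‖ ≤ Real.exp M * ‖f 0‖)
    (hre : ∀ z, ‖z‖ ≤ R → f z = 0 → z.re ≤ 0)
    (hη : 0 < η) (hηR : η < R) (hfη : f (-η) = 0) :
    -(deriv f 0 / f 0).re ≤ 16 * M / R - 1 / η + 1 / R := by
  have hn : ‖(-η : ℂ)‖ = η := by rw [norm_neg, norm_real, Real.norm_eq_abs, abs_of_pos hη]
  have hf0 := norm_pos_iff.mpr h0
  obtain ⟨g, hg, hg0, hgB, hgz, hgd⟩ := exists_blaschke_quotient hR hf h0 hM hfη (by rwa [hn])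
  have h2 : 1 ≤ R / η := by rw [le_div_iff₀ hη]; linarith
  have hg0' : ‖f 0‖ ≤ ‖g 0‖ := by rw [hg0, hn]; nlinarith
  have h3 := neg_re_logDeriv_le hR hg (norm_pos_iff.mp (by linarith))
    (fun z hz ↦ (hgB z hz).trans (by gcongr)) (fun z hz h ↦ hre z hz (hgz z hz h))
  have h4 := re_inv_sub_conj_div (-η) R
  have h5 : (-η : ℂ).re * (1 / ‖(-η : ℂ)‖ ^ 2 - 1 / R ^ 2) = - (1 / η) + η / R ^ 2 := by
    rw [hn, neg_re, ofReal_re]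
    field_simp
    ring
  have h6 : η / R ^ 2 ≤ 1 / R := by
    rw [div_le_div_iff₀ (by positivity) hR]
    nlinarith
  rw [hgd]
  simp only [add_re, sub_re] at h4 ⊢
  linarith

open MeasureTheory Filter Topology Asymptotics in
/-- For `0 < Re s`, `ζ(s) - 1/(s-1)` equals `1 - s ∫₁^∞ {t} t^{-s-1} dt`, hence is
`O(1 + |s| / Re s)`. -/
theorem norm_riemannZeta₀_le {s : ℂ} (hs : 0 < s.re) : ‖riemannZeta₀ s‖ ≤ 1 + ‖s‖ / s.re := by
  set f : ℝ → ℂ := (Ioi 1).indicator fun t ↦ ((t - ⌊t⌋₊ : ℝ) : ℂ) with hf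
  have hmeas : Measurable fun t : ℝ ↦ ((t - ⌊t⌋₊ : ℝ) : ℂ) :=
    Complex.measurable_ofReal.comp
      (measurable_id.sub (measurable_from_nat.comp Nat.measurable_floor))
  have hfm : Measurable f := hmeas.indicator measurableSet_Ioi
  have hfr : ∀ t : ℝ, 1 < t → ‖((t - ⌊t⌋₊ : ℝ) : ℂ)‖ ≤ 1 := by
    intro t ht
    rw [Complex.norm_real, Real.norm_eq_abs, abs_le]
    have h1 := Nat.floor_le (zero_le_one.trans ht.le)
    have h2 := Nat.lt_floor_add_one t
    constructor <;> linarith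
  have hfb : ∀ t, ‖f t‖ ≤ 1 := by
    intro t
    by_cases ht : t ∈ Ioi (1 : ℝ)
    · rw [hf, indicator_of_mem ht]; exact hfr t ht
    · rw [hf, indicator_of_notMem ht]; simp
  have hmel : ∀ z : ℂ, mellin f z = ∫ t in Ioi (1 : ℝ), (t : ℂ) ^ (z - 1) * ((t - ⌊t⌋₊ : ℝ) : ℂ) := by
    intro z
    have h1 : ∀ t : ℝ, (t : ℂ) ^ (z - 1) • f t =
        (Ioi (1 : ℝ)).indicator (fun t : ℝ ↦ (t : ℂ) ^ (z - 1) * ((t - ⌊t⌋₊ : ℝ) : ℂ)) t := by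
      intro t
      by_cases ht : t ∈ Ioi (1 : ℝ)
      · rw [hf, indicator_of_mem ht, indicator_of_mem ht, smul_eq_mul]
      · rw [hf, indicator_of_notMem ht, indicator_of_notMem ht, smul_zero]
    simp only [mellin, h1]
    rw [setIntegral_indicator measurableSet_Ioi, inter_eq_self_of_subset_right]
    exact Ioi_subset_Ioi zero_le_one
  have hdiff : ∀ z : ℂ, z.re < 0 → DifferentiableAt ℂ (mellin f) z := by
    intro z hz
    refine mellin_differentiableAt_of_isBigO_rpow (a := 0) (b := z.re - 1) ?_ ?_ hz ?_ (by linarith)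
    · have : LocallyIntegrable f := by
        refine (locallyIntegrable_const (1 : ℝ)).mono hfm.aestronglyMeasurable ?_
        exact Eventually.of_forall fun t ↦ by simpa using hfb t
      exact this.locallyIntegrableOn _
    · simp only [neg_zero, Real.rpow_zero]
      exact IsBigO.of_bound 1 (Eventually.of_forall fun t ↦ by simpa using hfb t)
    · refine (EventuallyEq.trans_isBigO (f₂ := fun _ ↦ (0 : ℂ)) ?_ (isBigO_zero _ _))
      filter_upwards [Ioo_mem_nhdsGT (zero_lt_one (α := ℝ))] with t ht
      rw [hf, indicator_of_notMem]
      simpa using ht.2.le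
  have hlarge : ∀ z : ℂ, 1 < z.re → riemannZeta₀ z = 1 - z * mellin f (-z) := by
    intro z hz
    have hz1 : z ≠ 1 := by rintro rfl; simp at hz
    have h1 := LSeries_eq_mul_integral' (fun _ ↦ 1) zero_le_one (s := z) (r := 1) hz (by
      refine IsBigO.of_bound 1 (Eventually.of_forall fun n ↦ by simp))
    have h2 : LSeries (fun _ ↦ 1) z = riemannZeta z := LSeries_one_eq_riemannZeta hz
    have hi1 : IntegrableOn (fun t : ℝ ↦ (t : ℂ) ^ (-z)) (Ioi 1) :=
      integrableOn_Ioi_cpow_of_lt (by simpa using hz) one_pos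
    have hi2 : IntegrableOn (fun t : ℝ ↦ (t : ℂ) ^ (-z - 1) * ((t - ⌊t⌋₊ : ℝ) : ℂ)) (Ioi 1) := by
      refine Integrable.mul_bdd (c := 1) (integrableOn_Ioi_cpow_of_lt (by simp; linarith) one_pos)
        hmeas.aestronglyMeasurable ?_
      filter_upwards [ae_restrict_mem measurableSet_Ioi] with t ht
      exact hfr t ht
    have h3 : ∫ t in Ioi (1 : ℝ), (∑ k ∈ Finset.Icc 1 ⌊t⌋₊, (1 : ℂ)) * (t : ℂ) ^ (-(z + 1)) =
        (∫ t in Ioi (1 : ℝ), (t : ℂ) ^ (-z)) -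
          ∫ t in Ioi (1 : ℝ), (t : ℂ) ^ (-z - 1) * ((t - ⌊t⌋₊ : ℝ) : ℂ) := by
      rw [← integral_sub hi1 hi2]
      refine setIntegral_congr_fun measurableSet_Ioi fun t ht ↦ ?_
      have ht0 : (t : ℂ) ≠ 0 := by
        have : (0 : ℝ) < t := one_pos.trans ht
        exact_mod_cast this.ne'
      have : (t : ℂ) ^ (-z) = (t : ℂ) ^ (-z - 1) * t := by
        rw [cpow_sub _ _ ht0, cpow_one, div_mul_cancel₀ _ ht0]
      simp only [Finset.sum_const, Nat.card_Icc, add_tsub_cancel_right, nsmul_eq_mul, mul_one]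
      rw [this, neg_add', Complex.ofReal_sub, Complex.ofReal_natCast]
      ring
    rw [h2, h3, ← hmel, integral_Ioi_cpow_of_lt (by simpa using hz) one_pos] at h1
    have hz1' : z - 1 ≠ 0 := sub_ne_zero.mpr hz1
    have hz1'' : -z + 1 ≠ 0 := by rw [← neg_ne_zero]; ring_nf; simpa [sub_eq_neg_add] using hz1'
    rw [riemannZeta_eq_inv_sub_add hz1] at h1
    rw [← add_right_inj (z - 1)⁻¹, h1]
    rw [show -z + 1 = -(z - 1) by ring]
    simp only [ofReal_one, one_cpow]
    field_simp
    ring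
  have hall : EqOn riemannZeta₀ (fun z ↦ 1 - z * mellin f (-z)) {z | 0 < z.re} := by
    have hopen : IsOpen {z : ℂ | 0 < z.re} := isOpen_lt continuous_const continuous_re
    refine AnalyticOnNhd.eqOn_of_preconnected_of_eventuallyEq (z₀ := 2)
      (differentiable_riemannZeta₀.differentiableOn.analyticOnNhd hopen)
      (DifferentiableOn.analyticOnNhd ?_ hopen) (convex_halfSpace_re_gt 0).isPreconnected (by simp) ?_
    · intro z hz
      have : DifferentiableAt ℂ (fun z ↦ mellin f (-z)) z :=
        (hdiff (-z) (by simpa using hz)).comp z differentiableAt_id.neg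
      exact ((differentiableAt_const 1).sub (differentiableAt_id.mul this)).differentiableWithinAt
    · filter_upwards [(isOpen_lt continuous_const continuous_re).mem_nhds
        (show (1 : ℝ) < (2 : ℂ).re by norm_num)] with z hz using hlarge z hz
  rw [hall hs]
  have hint : ‖mellin f (-s)‖ ≤ 1 / s.re := by
    rw [hmel]
    have := norm_integral_le_of_norm_le (f := fun t : ℝ ↦ (t : ℂ) ^ (-s - 1) * ((t - ⌊t⌋₊ : ℝ) : ℂ))
      (integrableOn_Ioi_rpow_of_lt (a := -s.re - 1) (by linarith) one_pos) ?_
    · refine this.trans_eq ?_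
      rw [integral_Ioi_rpow_of_lt (by linarith) one_pos]
      simp
    · filter_upwards [ae_restrict_mem measurableSet_Ioi] with t ht
      have ht0 : 0 < t := one_pos.trans (mem_Ioi.mp ht)
      rw [norm_mul, norm_cpow_eq_rpow_re_of_pos ht0]
      refine (mul_le_of_le_one_right (by positivity) (hfr t ht)).trans_eq ?_
      simp
  calc ‖1 - s * mellin f (-s)‖ ≤ 1 + ‖s‖ * ‖mellin f (-s)‖ := by
        rw [← norm_mul]; simpa using norm_sub_le (1 : ℂ) (s * mellin f (-s))
    _ ≤ 1 + ‖s‖ * (1 / s.re) := by gcongr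
    _ = _ := by ring

theorem norm_riemannZeta₁_le {s : ℂ} (hs : 1 / 2 ≤ s.re) : ‖riemannZeta₁ s‖ ≤ 4 * (1 + ‖s‖) ^ 2 := by
  have h0 : ‖riemannZeta₀ s‖ ≤ 1 + 2 * ‖s‖ := by
    refine (norm_riemannZeta₀_le (by linarith)).trans ?_
    have : ‖s‖ / s.re ≤ ‖s‖ / (1 / 2) := by gcongr
    linarith
  have h1 : ‖s - 1‖ ≤ ‖s‖ + 1 := by simpa using norm_sub_le s 1
  have hn := norm_nonneg s
  calc ‖riemannZeta₁ s‖ ≤ 1 + ‖s - 1‖ * ‖riemannZeta₀ s‖ := by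
        rw [riemannZeta₁, ← norm_mul]; simpa using norm_add_le (1 : ℂ) ((s - 1) * riemannZeta₀ s)
    _ ≤ 1 + (‖s‖ + 1) * (1 + 2 * ‖s‖) := by gcongr
    _ ≤ _ := by nlinarith

theorem half_le_norm_riemannZeta₁ {s : ℂ} (hs : ‖s - 1‖ ≤ 1 / 5) : 1 / 2 ≤ ‖riemannZeta₁ s‖ := by
  have hre : 4 / 5 ≤ s.re := by
    have := (abs_re_le_norm (s - 1)).trans hs
    rw [sub_re, one_re, abs_le] at this
    linarith
  have hn : ‖s‖ ≤ 6 / 5 := by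
    calc ‖s‖ = ‖(s - 1) + 1‖ := by ring_nf
      _ ≤ ‖s - 1‖ + 1 := by simpa using norm_add_le (s - 1) 1
      _ ≤ _ := by linarith
  have h0 : ‖riemannZeta₀ s‖ ≤ 5 / 2 := by
    refine (norm_riemannZeta₀_le (by linarith)).trans ?_
    have : ‖s‖ / s.re ≤ (6 / 5) / (4 / 5) := by gcongr
    linarith
  have h1 : ‖(s - 1) * riemannZeta₀ s‖ ≤ 1 / 2 := by
    rw [norm_mul]
    calc _ ≤ (1 / 5 : ℝ) * (5 / 2) := by gcongr
      _ = _ := by norm_num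
  have h2 := norm_sub_norm_le (1 : ℂ) (-((s - 1) * riemannZeta₀ s))
  rw [norm_neg, sub_neg_eq_add, norm_one] at h2
  rw [riemannZeta₁]
  linarith

theorem riemannZeta₁_ne_zero_of_norm_sub_one_le {s : ℂ} (hs : ‖s - 1‖ ≤ 1 / 5) :
    riemannZeta₁ s ≠ 0 := by
  have := half_le_norm_riemannZeta₁ hs
  rw [← norm_pos_iff]
  linarith

theorem riemannZeta₁_ne_zero_of_one_le_re {s : ℂ} (hs : 1 ≤ s.re) : riemannZeta₁ s ≠ 0 := by
  by_cases h : s = 1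
  · simp [h]
  · intro h0
    apply riemannZeta_ne_zero_of_one_le_re hs
    rw [riemannZeta_eq_inv_sub_mul h, h0, mul_zero]

/-- Lower bound for `ζ` to the right of the line `Re s = 1`, from the Möbius function. -/
theorem le_norm_riemannZeta {s : ℂ} (h1 : 1 < s.re) (h2 : s.re ≤ 2) :
    (s.re - 1) / 3 ≤ ‖riemannZeta s‖ := by
  have hmul := ArithmeticFunction.LSeries_zeta_mul_Lseries_moebius h1
  rw [ArithmeticFunction.LSeries_zeta_eq_riemannZeta h1] at hmul
  have hsum := ArithmeticFunction.LSeriesSummable_moebius_iff.mpr h1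
  set μ : ℕ → ℂ := fun n ↦ (ArithmeticFunction.moebius n : ℂ)
  have hmob : ‖LSeries μ s‖ ≤ ‖riemannZeta s.re‖ := by
    have hone : Summable fun n : ℕ ↦ 1 / (n : ℝ) ^ s.re := Real.summable_one_div_nat_rpow.mpr h1
    have hzeta : riemannZeta s.re = ((∑' n : ℕ, 1 / (n : ℝ) ^ s.re : ℝ) : ℂ) := by
      rw [zeta_eq_tsum_one_div_nat_cpow (by simpa using h1), ofReal_tsum]
      refine tsum_congr fun n ↦ ?_
      rw [ofReal_div, ofReal_cpow (Nat.cast_nonneg n)]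
      simp
    rw [hzeta, norm_real, Real.norm_of_nonneg (tsum_nonneg fun n ↦ by positivity)]
    refine (norm_tsum_le_tsum_norm hsum.norm).trans (hsum.norm.tsum_le_tsum ?_ hone)
    intro n
    rw [LSeries.norm_term_eq]
    split_ifs with hn
    · positivity
    · gcongr
      rw [norm_intCast]
      exact_mod_cast ArithmeticFunction.abs_moebius_le_one
  have hz : ‖riemannZeta s.re‖ ≤ 3 / (s.re - 1) := by
    have hne : (s.re : ℂ) ≠ 1 := by
      intro h
      rw [← ofReal_one, ofReal_inj] at h
      linarith
    rw [riemannZeta_eq_inv_sub_add hne]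
    have h3 : ‖riemannZeta₀ s.re‖ ≤ 2 := by
      refine (norm_riemannZeta₀_le (by simp; linarith)).trans_eq ?_
      rw [norm_real, Real.norm_of_nonneg (by linarith), ofReal_re, div_self (by linarith)]
      norm_num
    have h4 : ‖((s.re : ℂ) - 1)⁻¹‖ = 1 / (s.re - 1) := by
      rw [norm_inv, ← ofReal_one, ← ofReal_sub, norm_real, Real.norm_of_nonneg (by linarith), one_div]
    refine (norm_add_le _ _).trans ?_
    rw [h4, ← sub_nonneg]
    have : 2 ≤ 2 / (s.re - 1) := by rw [le_div_iff₀ (by linarith)]; linarith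
    have h5 : 3 / (s.re - 1) = 1 / (s.re - 1) + 2 / (s.re - 1) := by ring
    linarith
  have hpos : 0 < ‖riemannZeta s‖ := by
    rw [norm_pos_iff]; intro h; simp [h] at hmul
  have h6 : 1 ≤ ‖riemannZeta s‖ * (3 / (s.re - 1)) := by
    calc 1 = ‖riemannZeta s * LSeries μ s‖ := by rw [hmul, norm_one]
      _ = ‖riemannZeta s‖ * ‖LSeries μ s‖ := norm_mul _ _
      _ ≤ _ := by gcongr; exact hmob.trans hz
  have h7 : 0 < s.re - 1 := by linarith
  rw [mul_div_assoc', le_div_iff₀ h7] at h6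
  linarith

theorem norm_riemannZeta₁_le_exp_mul {s w : ℂ} (h1 : 1 < s.re) (h2 : s.re ≤ 2)
    (hw : ‖w - s‖ ≤ 1 / 2) :
    ‖riemannZeta₁ w‖ ≤
      Real.exp (4 + 2 * Real.log (|s.im| + 3) + 2 * Real.log (1 / (s.re - 1))) *
        ‖riemannZeta₁ s‖ := by
  have hd : 0 < s.re - 1 := by linarith
  have hne : s ≠ 1 := by rintro rfl; simp at h1
  have hwre : 1 / 2 ≤ w.re := by
    have := (abs_re_le_norm (w - s)).trans hw
    rw [sub_re, abs_le] at this
    linarith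
  have hwn : 1 + ‖w‖ ≤ 2 * (|s.im| + 3) := by
    have h3 : ‖w‖ ≤ ‖w - s‖ + ‖s‖ := by simpa using norm_add_le (w - s) s
    have h4 := norm_le_abs_re_add_abs_im s
    rw [abs_of_pos (by linarith)] at h4
    have := abs_nonneg s.im
    linarith
  have hlow : (s.re - 1) ^ 2 / 3 ≤ ‖riemannZeta₁ s‖ := by
    have h3 := le_norm_riemannZeta h1 h2
    rw [riemannZeta_eq_inv_sub_mul hne, norm_mul, norm_inv] at h3
    have h4 : s.re - 1 ≤ ‖s - 1‖ := by simpa using (le_abs_self _).trans (abs_re_le_norm (s - 1))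
    have h5 : 0 < ‖s - 1‖ := hd.trans_le h4
    rw [inv_mul_eq_div, le_div_iff₀ h5] at h3
    nlinarith
  have hexp : Real.exp (4 + 2 * Real.log (|s.im| + 3) + 2 * Real.log (1 / (s.re - 1))) =
      Real.exp 4 * (|s.im| + 3) ^ 2 / (s.re - 1) ^ 2 := by
    have h3 : 0 < |s.im| + 3 := by positivity
    rw [Real.exp_add, Real.exp_add, mul_comm 2, mul_comm 2, Real.exp_mul, Real.exp_mul,
      Real.exp_log h3, Real.exp_log (by positivity)]
    norm_cast
    field_simp
  have he : 48 ≤ Real.exp 4 := by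
    have h3 := Real.exp_one_gt_d9
    have : Real.exp 4 = Real.exp 1 ^ 4 := by rw [← Real.exp_nat_mul]; norm_num
    rw [this]
    calc (48 : ℝ) ≤ 2.7 ^ 4 := by norm_num
      _ ≤ _ := by gcongr; linarith
  rw [hexp]
  calc ‖riemannZeta₁ w‖ ≤ 4 * (1 + ‖w‖) ^ 2 := norm_riemannZeta₁_le hwre
    _ ≤ 4 * (2 * (|s.im| + 3)) ^ 2 := by gcongr
    _ = (48 * (|s.im| + 3) ^ 2 / (s.re - 1) ^ 2) * ((s.re - 1) ^ 2 / 3) := by field_simp; ring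
    _ ≤ _ := by gcongr

/-- `3 + 4 cos θ + cos 2θ ≥ 0` summed over the Dirichlet series of the negative logarithmic
derivative of `ζ`. -/
theorem re_logDeriv_riemannZeta_comb_nonneg {σ : ℝ} (hσ : 1 < σ) (t : ℝ) :
    0 ≤ 3 * (-deriv riemannZeta σ / riemannZeta σ).re +
      4 * (-deriv riemannZeta (σ + t * I) / riemannZeta (σ + t * I)).re +
      (-deriv riemannZeta (σ + 2 * t * I) / riemannZeta (σ + 2 * t * I)).re := by
  have key : ∀ u : ℝ, HasSum (fun n ↦ (LSeries.term (fun n ↦ (ArithmeticFunction.vonMangoldt n : ℂ))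
      (σ + u * I) n).re) (-deriv riemannZeta (σ + u * I) / riemannZeta (σ + u * I)).re := by
    intro u
    have hre : 1 < ((σ : ℂ) + u * I).re := by simpa using hσ
    rw [← ArithmeticFunction.LSeries_vonMangoldt_eq_deriv_riemannZeta_div hre]
    exact hasSum_re (ArithmeticFunction.LSeriesSummable_vonMangoldt hre).hasSum
  have h0 := key 0
  have h1 := key t
  have h2 := key (2 * t)
  simp only [ofReal_zero, zero_mul, add_zero, ofReal_mul, ofReal_ofNat] at h0 h2
  refine ((h0.mul_left 3).add (h1.mul_left 4) |>.add h2).nonneg fun n ↦ ?_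
  rcases eq_or_ne n 0 with rfl | hn
  · simp
  have hn0 : (n : ℂ) ≠ 0 := by exact_mod_cast hn
  have hterm : ∀ u : ℂ, LSeries.term (fun n ↦ (ArithmeticFunction.vonMangoldt n : ℂ))
      (σ + u * I) n = ((ArithmeticFunction.vonMangoldt n / (n : ℝ) ^ σ : ℝ) : ℂ) *
        exp (-(u * I * Real.log n)) := by
    intro u
    rw [LSeries.term_of_ne_zero hn, cpow_add _ _ hn0, cpow_def_of_ne_zero hn0 (u * I),
      natCast_log, mul_comm (Complex.log n), exp_neg, ofReal_div, ofReal_cpow (by positivity)]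
    simp only [div_eq_mul_inv, mul_inv, ofReal_natCast]
    ring
  have hcos : ∀ u : ℝ, (LSeries.term (fun n ↦ (ArithmeticFunction.vonMangoldt n : ℂ))
      (σ + u * I) n).re = ArithmeticFunction.vonMangoldt n / (n : ℝ) ^ σ *
        Real.cos (u * Real.log n) := by
    intro u
    rw [hterm, re_ofReal_mul,
      show -((u : ℂ) * I * Real.log n) = ((-(u * Real.log n) : ℝ) : ℂ) * I by push_cast; ring,
      exp_ofReal_mul_I_re, Real.cos_neg]
  have e0 := hcos 0
  have e1 := hcos t
  have e2 := hcos (2 * t)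
  simp only [ofReal_zero, zero_mul, add_zero, ofReal_mul, ofReal_ofNat] at e0 e2
  rw [e0, e1, e2, mul_assoc 2 t, Real.cos_two_mul, Real.cos_zero]
  have hpos : 0 ≤ ArithmeticFunction.vonMangoldt n / (n : ℝ) ^ σ :=
    div_nonneg ArithmeticFunction.vonMangoldt_nonneg (by positivity)
  nlinarith [mul_nonneg hpos (sq_nonneg (1 + Real.cos (t * Real.log n)))]

theorem neg_deriv_div_riemannZeta_eq {s : ℂ} (h : s ≠ 1) (h0 : riemannZeta₁ s ≠ 0) :
    -deriv riemannZeta s / riemannZeta s = -(deriv riemannZeta₁ s / riemannZeta₁ s) + 1 / (s - 1) := by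
  have h1 : s - 1 ≠ 0 := sub_ne_zero.mpr h
  rw [deriv_riemannZeta_eq_neg_inv_sub_sq_mul_add h, riemannZeta_eq_inv_sub_mul h]
  field_simp
  ring

theorem neg_re_logDeriv_riemannZeta₁_le {s : ℂ} (h1 : 1 < s.re) (h2 : s.re ≤ 2) :
    -(deriv riemannZeta₁ s / riemannZeta₁ s).re ≤
      32 * (4 + 2 * Real.log (|s.im| + 3) + 2 * Real.log (1 / (s.re - 1))) := by
  have h := neg_re_logDeriv_le (f := fun z ↦ riemannZeta₁ (s + z))
    (M := 4 + 2 * Real.log (|s.im| + 3) + 2 * Real.log (1 / (s.re - 1))) (R := 1 / 2) (by norm_num)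
    (by fun_prop) (by simpa using riemannZeta₁_ne_zero_of_one_le_re h1.le)
    (fun z hz ↦ by simpa using norm_riemannZeta₁_le_exp_mul h1 h2 (w := s + z) (by simpa using hz))
    (fun z _ h ↦ by
      by_contra! hz
      exact riemannZeta₁_ne_zero_of_one_le_re (s := s + z) (by rw [add_re]; linarith) h)
  rw [deriv_comp_const_add (f := riemannZeta₁)] at h
  simp only [add_zero] at h
  linarith

theorem neg_re_logDeriv_riemannZeta₁_le_of_zero {s : ℂ} {η : ℝ} (h1 : 1 < s.re) (h2 : s.re ≤ 2)
    (hη : 0 < η) (hη' : η < 1 / 2) (h0 : riemannZeta₁ (s - η) = 0) :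
    -(deriv riemannZeta₁ s / riemannZeta₁ s).re ≤
      32 * (4 + 2 * Real.log (|s.im| + 3) + 2 * Real.log (1 / (s.re - 1))) - 1 / η + 2 := by
  have h := neg_re_logDeriv_le_of_zero (f := fun z ↦ riemannZeta₁ (s + z))
    (M := 4 + 2 * Real.log (|s.im| + 3) + 2 * Real.log (1 / (s.re - 1))) (R := 1 / 2) (by norm_num)
    (by fun_prop) (by simpa using riemannZeta₁_ne_zero_of_one_le_re h1.le)
    (fun z hz ↦ by simpa using norm_riemannZeta₁_le_exp_mul h1 h2 (w := s + z) (by simpa using hz))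
    (fun z _ h ↦ by
      by_contra! hz
      exact riemannZeta₁_ne_zero_of_one_le_re (s := s + z) (by rw [add_re]; linarith) h)
    hη hη' (by simpa [sub_eq_add_neg] using h0)
  rw [deriv_comp_const_add (f := riemannZeta₁)] at h
  simp only [add_zero] at h
  linarith

theorem four_div_le_of_riemannZeta₁_eq_zero {σ β γ : ℝ} (hγ : 1 / 10 ≤ |γ|) (h1 : 1 < σ)
    (h2 : σ ≤ 2) (hβ : β < σ) (hβ' : σ - β < 1 / 2) (h0 : riemannZeta₁ (β + γ * I) = 0) :
    4 / (σ - β) ≤ 3 / (σ - 1) +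
      256 * (4 + 2 * Real.log (2 * |γ| + 3) + 2 * Real.log (1 / (σ - 1))) + 508 := by
  have hd : 0 < σ - 1 := by linarith
  have hcomb := re_logDeriv_riemannZeta_comb_nonneg h1 γ
  have hne : ∀ u : ℝ, (σ : ℂ) + u * I ≠ 1 := fun u h ↦ by
    have := congrArg re h; simp at this; linarith
  have hnz : ∀ u : ℝ, riemannZeta₁ ((σ : ℂ) + u * I) ≠ 0 := fun u ↦
    riemannZeta₁_ne_zero_of_one_le_re (by simpa using h1.le)
  have hre : ∀ u : ℝ, (-deriv riemannZeta (σ + u * I) / riemannZeta (σ + u * I)).re =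
      -(deriv riemannZeta₁ (σ + u * I) / riemannZeta₁ (σ + u * I)).re +
        (σ - 1) / ((σ - 1) ^ 2 + u ^ 2) := by
    intro u
    rw [neg_deriv_div_riemannZeta_eq (hne u) (hnz u), add_re, neg_re,
      one_div, inv_re, normSq_apply]
    simp [sq]
  have hfrac : ∀ u : ℝ, 1 / 10 ≤ |u| → (σ - 1) / ((σ - 1) ^ 2 + u ^ 2) ≤ 100 := by
    intro u hu
    have h3 : (1 / 10) ^ 2 ≤ u ^ 2 := by rw [← sq_abs u]; gcongr
    rw [div_le_iff₀ (by positivity)]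
    nlinarith
  have e0 := hre 0
  have e1 := hre γ
  have e2 := hre (2 * γ)
  simp only [ofReal_zero, zero_mul, add_zero, ofReal_mul, ofReal_ofNat] at e0 e2
  rw [e0, e1, e2] at hcomb
  have b1 := hfrac γ hγ
  have b2 := hfrac (2 * γ) (by rw [abs_mul, abs_two]; linarith)
  have b0 : (σ - 1) / ((σ - 1) ^ 2 + 0 ^ 2) = 1 / (σ - 1) := by field_simp; ring
  have a0 := neg_re_logDeriv_riemannZeta₁_le (s := σ) (by simpa using h1) (by simpa using h2)
  have a1 := neg_re_logDeriv_riemannZeta₁_le_of_zero (s := σ + γ * I) (η := σ - β)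
    (by simpa using h1) (by simpa using h2) (by linarith) hβ' (by rw [← h0]; push_cast; ring_nf)
  have a2 := neg_re_logDeriv_riemannZeta₁_le (s := σ + 2 * γ * I) (by simpa using h1)
    (by simpa using h2)
  simp only [ofReal_re, ofReal_im, abs_zero, add_re, add_im, mul_re, mul_im, I_re, I_im, mul_zero,
    mul_one, sub_zero, zero_mul, add_zero, zero_add, re_ofNat, im_ofNat, abs_mul, abs_two, sub_self]
    at a0 a1 a2
  have hpos := abs_nonneg γ
  have l0 : Real.log 3 ≤ Real.log (2 * |γ| + 3) := Real.log_le_log (by norm_num) (by linarith)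
  have l1 : Real.log (|γ| + 3) ≤ Real.log (2 * |γ| + 3) :=
    Real.log_le_log (by positivity) (by linarith)
  rw [b0] at hcomb
  have e4 : 4 / (σ - β) = 4 * (1 / (σ - β)) := by ring
  have e3 : 3 / (σ - 1) = 3 * (1 / (σ - 1)) := by ring
  rw [e4, e3]
  linarith

theorem one_le_log_abs_add_three (t : ℝ) : 1 ≤ Real.log (|t| + 3) := by
  rw [Real.le_log_iff_exp_le (by positivity)]
  have := Real.exp_one_lt_d9
  have := abs_nonneg t
  linarith

/-- The classical zero-free region of de la Vallée Poussin. -/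
theorem exists_riemannZeta₁_zero_free :
    ∃ c : ℝ, 0 < c ∧ c ≤ 1 / 10 ∧
      ∀ s : ℂ, 1 - c / Real.log (|s.im| + 3) ≤ s.re → riemannZeta₁ s ≠ 0 := by
  obtain ⟨b, hb0, hb⟩ : ∃ b : ℝ, 0 < b ∧ b ≤ 1 / 20000 := ⟨1 / 20000, by norm_num, le_rfl⟩
  set a := b ^ 2 with ha
  have ha0 : 0 < a := by positivity
  have ha1 : a ≤ 1 / 20000 := by nlinarith
  refine ⟨a / 7, by positivity, by linarith, fun s hs h0 ↦ ?_⟩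
  set ℒ := Real.log (|s.im| + 3) with hℒ
  have hℒ1 : 1 ≤ ℒ := one_le_log_abs_add_three _
  by_cases h1 : 1 ≤ s.re
  · exact riemannZeta₁_ne_zero_of_one_le_re h1 h0
  push Not at h1
  have hdiv : a / 7 / ℒ ≤ a / 7 := div_le_self (by positivity) hℒ1
  by_cases hγ : |s.im| < 1 / 10
  · refine riemannZeta₁_ne_zero_of_norm_sub_one_le (s := s) ?_ h0
    refine (norm_le_abs_re_add_abs_im _).trans ?_
    have : |(s - 1).re| ≤ 1 / 10 := by
      rw [sub_re, one_re, abs_le]; constructor <;> linarith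
    have h3 : (s - 1).im = s.im := by simp
    rw [h3]
    linarith
  push Not at hγ
  have haℒ : 0 < a / ℒ := by positivity
  have haℒ' : a / ℒ ≤ a := div_le_self ha0.le hℒ1
  have key := four_div_le_of_riemannZeta₁_eq_zero (σ := 1 + a / ℒ) (β := s.re) hγ (by linarith)
    (by linarith) (by linarith) (by linarith) (by rwa [re_add_im])
  rw [add_sub_cancel_left] at key
  have hlog2 : Real.log (2 * |s.im| + 3) ≤ 2 * ℒ := by
    rw [hℒ, ← Real.log_rpow (by positivity)]
    refine Real.log_le_log (by positivity) ?_
    norm_cast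
    nlinarith [abs_nonneg s.im]
  have hlog3 : Real.log (1 / (a / ℒ)) ≤ 2 * (ℒ / b) := by
    have h3 : 1 / (a / ℒ) ≤ (ℒ / b) ^ 2 := by
      rw [one_div_div, div_pow, ← ha]
      gcongr
      nlinarith
    calc Real.log (1 / (a / ℒ)) ≤ Real.log ((ℒ / b) ^ 2) := Real.log_le_log (by positivity) h3
      _ = 2 * Real.log (ℒ / b) := by rw [Real.log_pow]; norm_num
      _ ≤ 2 * (ℒ / b) := by
        have := Real.log_le_sub_one_of_pos (show 0 < ℒ / b by positivity)
        linarith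
  have hb1 : 1 ≤ ℒ / b := by rw [le_div_iff₀ hb0]; linarith
  have hb2 : ℒ ≤ ℒ / b := by rw [le_div_iff₀ hb0]; nlinarith
  have hup : 4 / (1 + a / ℒ - s.re) ≤ 3 * (ℒ / a) + 4000 * (ℒ / b) := by
    have e3 : 3 / (a / ℒ) = 3 * (ℒ / a) := by field_simp
    rw [e3] at key
    linarith
  have hba : 4000 * (ℒ / b) ≤ 1 / 5 * (ℒ / a) := by
    have : ℒ / a = ℒ / b / b := by rw [ha, sq, div_div]
    have h9 : 20000 * (ℒ / b) ≤ ℒ / b / b := by rw [le_div_iff₀ hb0]; nlinarith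
    rw [this]
    linarith
  have hup2 : 4 / (1 + a / ℒ - s.re) ≤ 16 / 5 * (ℒ / a) := by linarith
  rw [div_le_iff₀ (by linarith)] at hup2
  have e5 : a / 7 / ℒ = 1 / 7 * (a / ℒ) := by ring
  have hle : 1 + a / ℒ - s.re ≤ 8 / 7 * (a / ℒ) := by rw [e5] at hs; linarith
  have : 16 / 5 * (ℒ / a) * (1 + a / ℒ - s.re) ≤ 16 / 5 * (ℒ / a) * (8 / 7 * (a / ℒ)) := by gcongr
  have e6 : 16 / 5 * (ℒ / a) * (8 / 7 * (a / ℒ)) = 128 / 35 := by field_simp; norm_num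
  linarith

theorem norm_logDeriv_riemannZeta_le {s : ℂ} (hs : 1 < s.re) :
    ‖-deriv riemannZeta s / riemannZeta s‖ ≤ ‖-deriv riemannZeta s.re / riemannZeta s.re‖ := by
  have hs' : 1 < (s.re : ℂ).re := by simpa using hs
  rw [← ArithmeticFunction.LSeries_vonMangoldt_eq_deriv_riemannZeta_div hs,
    ← ArithmeticFunction.LSeries_vonMangoldt_eq_deriv_riemannZeta_div hs']
  have h1 := ArithmeticFunction.LSeriesSummable_vonMangoldt hs
  have h2 : ∀ n, LSeries.term (fun n ↦ (ArithmeticFunction.vonMangoldt n : ℂ)) s.re n =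
      ((‖LSeries.term (fun n ↦ (ArithmeticFunction.vonMangoldt n : ℂ)) s n‖ : ℝ) : ℂ) := by
    intro n
    rw [LSeries.norm_term_eq, LSeries.term_def]
    split_ifs
    · simp
    · rw [norm_real, Real.norm_of_nonneg ArithmeticFunction.vonMangoldt_nonneg, ofReal_div,
        ofReal_cpow (Nat.cast_nonneg n), ofReal_natCast]
  have h3 : LSeries (fun n ↦ (ArithmeticFunction.vonMangoldt n : ℂ)) s.re =
      ((∑' n, ‖LSeries.term (fun n ↦ (ArithmeticFunction.vonMangoldt n : ℂ)) s n‖ : ℝ) : ℂ) := by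
    rw [LSeries, ofReal_tsum]
    exact tsum_congr h2
  rw [h3, norm_real, Real.norm_of_nonneg (tsum_nonneg fun n ↦ norm_nonneg _)]
  exact norm_tsum_le_tsum_norm h1.norm

theorem exists_norm_logDeriv_riemannZeta₁_le_div :
    ∃ C : ℝ, 0 < C ∧ ∀ s : ℂ, 1 < s.re → s.re ≤ 2 →
      ‖deriv riemannZeta₁ s / riemannZeta₁ s‖ ≤ C / (s.re - 1) := by
  have hcont : ContinuousOn (fun σ : ℝ ↦ deriv riemannZeta₁ σ / riemannZeta₁ σ) (Icc 1 2) := by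
    refine ContinuousOn.div ?_ ?_ ?_
    · exact (differentiable_riemannZeta₁.deriv.continuous.comp continuous_ofReal).continuousOn
    · exact (differentiable_riemannZeta₁.continuous.comp continuous_ofReal).continuousOn
    · intro σ hσ
      exact riemannZeta₁_ne_zero_of_one_le_re (by simpa using hσ.1)
  obtain ⟨B, hB⟩ := isCompact_Icc.exists_bound_of_continuousOn hcont
  have hB0 : 0 ≤ B := (norm_nonneg _).trans (hB 1 (by norm_num))
  refine ⟨B + 2, by positivity, fun s h1 h2 ↦ ?_⟩
  have hd : 0 < s.re - 1 := by linarith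
  have hne : ∀ u : ℂ, u.re = s.re → u ≠ 1 := fun u h h' ↦ by
    have := congrArg re h'; rw [one_re] at this; linarith
  have hnz : ∀ u : ℂ, u.re = s.re → riemannZeta₁ u ≠ 0 := fun u h ↦
    riemannZeta₁_ne_zero_of_one_le_re (by linarith)
  have hinv : ∀ u : ℂ, u.re = s.re → ‖1 / (u - 1)‖ ≤ 1 / (s.re - 1) := by
    intro u hu
    rw [norm_div, norm_one]
    gcongr
    simpa [hu] using (le_abs_self _).trans (abs_re_le_norm (u - 1))
  have h3 := norm_logDeriv_riemannZeta_le h1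
  have hsr : (s.re : ℂ).re = s.re := ofReal_re _
  rw [neg_deriv_div_riemannZeta_eq (hne _ hsr) (hnz _ hsr)] at h3
  have h4 : ‖deriv riemannZeta₁ s / riemannZeta₁ s‖ ≤
      ‖-deriv riemannZeta s / riemannZeta s‖ + ‖1 / (s - 1)‖ := by
    rw [neg_deriv_div_riemannZeta_eq (hne s rfl) (hnz s rfl), ← norm_neg]
    simpa using norm_sub_le (-(deriv riemannZeta₁ s / riemannZeta₁ s) + 1 / (s - 1)) (1 / (s - 1))
  have h5 := norm_add_le (-(deriv riemannZeta₁ s.re / riemannZeta₁ s.re)) (1 / ((s.re : ℂ) - 1))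
  rw [norm_neg] at h5
  have h6 := hB s.re ⟨h1.le, h2⟩
  have h7 := hinv s rfl
  have h8 := hinv s.re hsr
  have h9 : B ≤ B / (s.re - 1) := by rw [le_div_iff₀ hd]; nlinarith
  have e : (B + 2) / (s.re - 1) = B / (s.re - 1) + 1 / (s.re - 1) + 1 / (s.re - 1) := by ring
  rw [e]
  linarith

/-- In the classical zero-free region, the logarithmic derivative of `ζ₁(s) = (s-1)ζ(s)` is
bounded by `log²`. -/
theorem exists_norm_logDeriv_riemannZeta₁_le :
    ∃ c C : ℝ, 0 < c ∧ c ≤ 1 / 10 ∧ 0 < C ∧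
      ∀ s : ℂ, 1 - c / Real.log (|s.im| + 3) ≤ s.re → s.re ≤ 2 → riemannZeta₁ s ≠ 0 ∧
        ‖deriv riemannZeta₁ s / riemannZeta₁ s‖ ≤ C * Real.log (|s.im| + 3) ^ 2 := by
  obtain ⟨c₀, hc0, hc1, hfree⟩ := exists_riemannZeta₁_zero_free
  obtain ⟨C₁, hC1, hright⟩ := exists_norm_logDeriv_riemannZeta₁_le_div
  obtain ⟨b, hb⟩ : ∃ b, b = c₀ / 2 := ⟨_, rfl⟩
  have hb0 : 0 < b := by linarith
  have hb1 : b ≤ 1 / 20 := by linarith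
  refine ⟨b / 2, C₁ / b + 512 / b ^ 2, by positivity, by linarith, by positivity, fun s hs hs2 ↦ ?_⟩
  set ℒ := Real.log (|s.im| + 3) with hℒ
  have hℒ1 : 1 ≤ ℒ := one_le_log_abs_add_three _
  have hbℒ : 0 < b / ℒ := by positivity
  have hbℒ1 : b / ℒ ≤ b := div_le_self hb0.le hℒ1
  have e1 : b / 2 / ℒ = b / ℒ / 2 := by ring
  have hC0 : 0 < C₁ / b * ℒ ^ 2 := by positivity
  have hC2 : 0 < 512 / b ^ 2 * ℒ ^ 2 := by positivity
  refine ⟨hfree s (le_trans ?_ hs), ?_⟩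
  · gcongr; linarith
  rcases le_or_gt (1 + b / ℒ) s.re with h | h
  · refine (hright s (by linarith) hs2).trans ?_
    have h3 : C₁ / (s.re - 1) ≤ C₁ / (b / ℒ) := by gcongr; linarith
    have h4 : C₁ / (b / ℒ) ≤ C₁ / b * ℒ ^ 2 := by
      rw [div_div_eq_mul_div, mul_div_right_comm]
      gcongr
      nlinarith
    linarith
  set w : ℂ := (1 + b / ℒ : ℝ) + s.im * I with hw
  have hwre : w.re = 1 + b / ℒ := by simp [hw]
  have hwim : w.im = s.im := by simp [hw]
  set M := 4 + 2 * Real.log (|w.im| + 3) + 2 * Real.log (1 / (w.re - 1)) with hM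
  have hlogb : Real.log (1 / (w.re - 1)) ≤ ℒ / b := by
    rw [hwre, add_sub_cancel_left, one_div_div]
    have := Real.log_le_sub_one_of_pos (show 0 < ℒ / b by positivity)
    linarith
  have hlogb0 : 0 ≤ Real.log (1 / (w.re - 1)) := by
    apply Real.log_nonneg
    rw [hwre, add_sub_cancel_left, one_div_div, le_div_iff₀ hb0]
    linarith
  have hM0 : 0 ≤ M := by rw [hM, hwim, ← hℒ]; linarith
  have hM1 : M ≤ 8 * (ℒ / b) := by
    have : ℒ ≤ ℒ / b := by rw [le_div_iff₀ hb0]; nlinarith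
    rw [hM, hwim, ← hℒ]
    linarith
  have hsw : ‖s - w‖ ≤ 3 / 2 * (b / ℒ) := by
    have : s - w = ((s.re - (1 + b / ℒ) : ℝ) : ℂ) := by
      apply Complex.ext <;> simp [hw]
    rw [this, norm_real, Real.norm_eq_abs, abs_le]
    rw [e1] at hs
    constructor <;> linarith
  have key := norm_deriv_div_le_of_norm_le (f := riemannZeta₁) (c := w) (z := s) (M := M)
    (R := 2 * (b / ℒ)) differentiable_riemannZeta₁.differentiableOn ?_ hM0 ?_ ?_
  · refine key.trans ?_
    have h5 : b / ℒ / 2 ≤ 2 * (b / ℒ) - ‖s - w‖ := by linarith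
    calc 8 * M * (2 * (b / ℒ)) / (2 * (b / ℒ) - ‖s - w‖) ^ 2
        ≤ 8 * (8 * (ℒ / b)) * (2 * (b / ℒ)) / (b / ℒ / 2) ^ 2 := by gcongr
      _ = 512 / b ^ 2 * ℒ ^ 2 := by field_simp; norm_num
      _ ≤ _ := by linarith
  · intro z hz
    rw [mem_ball, dist_eq_norm] at hz
    have hre := (abs_re_le_norm _).trans_lt hz
    have him := (abs_im_le_norm _).trans_lt hz
    rw [sub_re, hwre, abs_lt] at hre
    rw [sub_im, hwim] at him
    have him' : |z.im| ≤ |s.im| + 1 := by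
      have := abs_sub_abs_le_abs_sub z.im s.im
      linarith
    apply hfree
    have h6 : Real.log (|z.im| + 3) ≤ 2 * ℒ := by
      rw [hℒ, ← Real.log_rpow (by positivity)]
      refine Real.log_le_log (by positivity) ?_
      norm_cast
      nlinarith [abs_nonneg s.im]
    have h7 : c₀ / (2 * ℒ) ≤ c₀ / Real.log (|z.im| + 3) := by
      have := one_le_log_abs_add_three z.im
      gcongr
    have h8 : c₀ / (2 * ℒ) = b / ℒ := by rw [hb]; field_simp
    linarith
  · intro z hz
    rw [mem_ball, dist_eq_norm] at hz
    exact norm_riemannZeta₁_le_exp_mul (by linarith) (by linarith) (by linarith)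
  · rw [mem_ball, dist_eq_norm]
    linarith

open MeasureTheory Filter Topology Asymptotics

/-- The error term `ψ(t) - t` in the prime number theorem. -/
noncomputable def psiError (t : ℝ) : ℝ := Chebyshev.psi t - t

/-- The primitive of `psiError` vanishing at `1`. -/
noncomputable def psiErrorPrimitive (u : ℝ) : ℝ := ∫ t in (1 : ℝ)..u, psiError t

theorem psi_le_six_mul {t : ℝ} (ht : 0 ≤ t) : Chebyshev.psi t ≤ 6 * t := by
  have h : Real.log 4 ≤ 2 := by
    rw [show (4 : ℝ) = 2 ^ 2 by norm_num, Real.log_pow]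
    have := Real.log_two_lt_d9
    push_cast
    linarith
  refine (Chebyshev.psi_le_const_mul_self ht).trans ?_
  gcongr
  linarith

theorem abs_psiError_le {t : ℝ} (ht : 0 ≤ t) : |psiError t| ≤ 6 * t := by
  have h1 := psi_le_six_mul ht
  have h2 := Chebyshev.psi_nonneg t
  rw [psiError, abs_le]
  constructor <;> linarith

theorem intervalIntegrable_psiError (a b : ℝ) : IntervalIntegrable psiError volume a b :=
  Chebyshev.psi_mono.intervalIntegrable.sub intervalIntegral.intervalIntegrable_id

theorem measurable_psiError : Measurable psiError :=
  Chebyshev.psi_mono.measurable.sub measurable_id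

theorem continuous_psiErrorPrimitive : Continuous psiErrorPrimitive :=
  intervalIntegral.continuous_primitive intervalIntegrable_psiError 1

theorem abs_psiErrorPrimitive_le {u : ℝ} (hu : 1 ≤ u) : |psiErrorPrimitive u| ≤ 6 * u ^ 2 := by
  have h := intervalIntegral.norm_integral_le_of_norm_le_const (a := 1) (b := u) (C := 6 * u)
    (f := psiError) fun t ht ↦ by
      rw [uIoc_of_le hu] at ht
      exact (abs_psiError_le (by linarith [ht.1])).trans (by linarith [ht.2])
  rw [abs_of_nonneg (by linarith : 0 ≤ u - 1)] at h
  refine h.trans ?_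
  nlinarith

theorem hasDerivWithinAt_psiErrorPrimitive {x : ℝ} (hx : 0 ≤ x) :
    HasDerivWithinAt psiErrorPrimitive (psiError x) (Ioi x) x := by
  refine HasDerivWithinAt.mono (t := Ici x) ?_ Ioi_subset_Ici_self
  refine intervalIntegral.integral_hasDerivWithinAt_right (t := Ioi x)
    (intervalIntegrable_psiError _ _) measurable_psiError.stronglyMeasurable.stronglyMeasurableAtFilter ?_
  refine ContinuousWithinAt.sub ?_ continuousWithinAt_id
  refine ContinuousWithinAt.congr_of_eventuallyEq (f := fun _ ↦ Chebyshev.psi x)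
    continuousWithinAt_const ?_ rfl
  filter_upwards [Ioo_mem_nhdsGT (Nat.lt_floor_add_one x)] with t ht
  rw [Chebyshev.psi_eq_psi_coe_floor t, Chebyshev.psi_eq_psi_coe_floor x]
  congr 2
  rw [Nat.floor_eq_iff (hx.trans ht.1.le)]
  exact ⟨(Nat.floor_le hx).trans ht.1.le, ht.2⟩

theorem integrableOn_psiError_mul_cpow {z : ℂ} (hz : 1 < z.re) :
    IntegrableOn (fun t : ℝ ↦ (psiError t : ℂ) * (t : ℂ) ^ (-(z + 1))) (Ioi 1) := by
  refine Integrable.mono' ((integrableOn_Ioi_rpow_of_lt (a := -z.re) (by linarith) one_pos).const_mul 6)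
    ?_ ?_
  · refine (AEStronglyMeasurable.mul ?_ ?_)
    · exact (Complex.measurable_ofReal.comp measurable_psiError).aestronglyMeasurable
    · exact (integrableOn_Ioi_cpow_of_lt (a := -(z + 1)) (by simp; linarith) one_pos).1
  · filter_upwards [ae_restrict_mem measurableSet_Ioi] with t ht
    have ht0 : 0 < t := one_pos.trans (mem_Ioi.mp ht)
    rw [norm_mul, norm_cpow_eq_rpow_re_of_pos ht0, norm_real]
    have h1 : t ^ (-z.re) = t * t ^ (-(z + 1)).re := by
      rw [neg_re, add_re, one_re, neg_add, Real.rpow_add ht0, Real.rpow_neg_one]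
      field_simp
    rw [h1, ← mul_assoc]
    gcongr
    exact abs_psiError_le ht0.le

theorem integral_psiError_mul_cpow {z : ℂ} (hz : 1 < z.re) :
    ∫ t in Ioi (1 : ℝ), (psiError t : ℂ) * (t : ℂ) ^ (-(z + 1)) =
      (-(deriv riemannZeta₁ z / riemannZeta₁ z) - 1) / z := by
  have hz0 : z ≠ 0 := by rintro rfl; simp at hz; linarith
  have hz1 : z ≠ 1 := by rintro rfl; simp at hz
  have hz1' : z - 1 ≠ 0 := sub_ne_zero.mpr hz1
  have hpsi : ∀ t : ℝ, (∑ k ∈ Finset.Icc 1 ⌊t⌋₊, (ArithmeticFunction.vonMangoldt k : ℂ)) =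
      (Chebyshev.psi t : ℂ) := by
    intro t
    rw [Chebyshev.psi_eq_sum_Icc, ofReal_sum, ← Finset.sum_Ioc_add_eq_sum_Icc (Nat.zero_le _)]
    simp [← Finset.Icc_add_one_left_eq_Ioc]
  have h1 := LSeries_eq_mul_integral_of_nonneg (fun n ↦ ArithmeticFunction.vonMangoldt n)
    zero_le_one (s := z) hz ?_ (fun _ ↦ ArithmeticFunction.vonMangoldt_nonneg)
  · rw [ArithmeticFunction.LSeries_vonMangoldt_eq_deriv_riemannZeta_div hz,
      neg_deriv_div_riemannZeta_eq hz1 (riemannZeta₁_ne_zero_of_one_le_re hz.le)] at h1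
    simp only [hpsi] at h1
    have hi1 : IntegrableOn (fun t : ℝ ↦ (t : ℂ) ^ (-z)) (Ioi 1) :=
      integrableOn_Ioi_cpow_of_lt (by simpa using hz) one_pos
    have h2 : ∫ t in Ioi (1 : ℝ), (Chebyshev.psi t : ℂ) * (t : ℂ) ^ (-(z + 1)) =
        (∫ t in Ioi (1 : ℝ), (psiError t : ℂ) * (t : ℂ) ^ (-(z + 1))) +
          ∫ t in Ioi (1 : ℝ), (t : ℂ) ^ (-z) := by
      rw [← integral_add (integrableOn_psiError_mul_cpow hz) hi1]
      refine setIntegral_congr_fun measurableSet_Ioi fun t ht ↦ ?_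
      have ht0 : (t : ℂ) ≠ 0 := by
        have : (0 : ℝ) < t := one_pos.trans (mem_Ioi.mp ht)
        exact_mod_cast this.ne'
      have : (t : ℂ) ^ (-z) = (t : ℂ) ^ (-(z + 1)) * t := by
        rw [neg_add', cpow_sub _ _ ht0, cpow_one, div_mul_cancel₀ _ ht0]
      simp only [psiError, ofReal_sub]
      rw [this]
      ring
    rw [h2, integral_Ioi_cpow_of_lt (by simpa using hz) one_pos] at h1
    rw [eq_div_iff hz0, mul_comm]
    rw [show -z + 1 = -(z - 1) by ring, mul_add, ofReal_one, one_cpow, ← sub_eq_iff_eq_add] at h1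
    rw [← h1]
    field_simp
    ring
  · refine IsBigO.of_bound 6 (Eventually.of_forall fun n ↦ ?_)
    have h3 : (∑ k ∈ Finset.Icc 1 n, ArithmeticFunction.vonMangoldt k) = Chebyshev.psi n := by
      have := hpsi n
      rw [Nat.floor_natCast] at this
      exact_mod_cast this
    rw [h3, Real.rpow_one, Real.norm_of_nonneg (Chebyshev.psi_nonneg _), Real.norm_natCast]
    exact psi_le_six_mul n.cast_nonneg

/-- The Mellin transform of `psiErrorPrimitive`, see `integral_psiErrorPrimitive_mul_cpow`. -/
noncomputable def psiErrorTransform (z : ℂ) : ℂ :=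
  (-(deriv riemannZeta₁ z / riemannZeta₁ z) - 1) / (z * (z + 1))

theorem integrableOn_psiErrorPrimitive_mul_cpow {z : ℂ} (hz : 1 < z.re) :
    IntegrableOn (fun t : ℝ ↦ (psiErrorPrimitive t : ℂ) * (t : ℂ) ^ (-(z + 2))) (Ioi 1) := by
  refine Integrable.mono' ((integrableOn_Ioi_rpow_of_lt (a := -z.re) (by linarith) one_pos).const_mul 6)
    ?_ ?_
  · refine (AEStronglyMeasurable.mul ?_ ?_)
    · exact (continuous_ofReal.comp continuous_psiErrorPrimitive).aestronglyMeasurable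
    · exact (integrableOn_Ioi_cpow_of_lt (a := -(z + 2)) (by simp; linarith) one_pos).1
  · filter_upwards [ae_restrict_mem measurableSet_Ioi] with t ht
    have ht0 : 0 < t := one_pos.trans (mem_Ioi.mp ht)
    rw [norm_mul, norm_cpow_eq_rpow_re_of_pos ht0, norm_real]
    have h1 : t ^ (-z.re) = t ^ 2 * t ^ (-(z + 2)).re := by
      rw [neg_re, add_re, re_ofNat, neg_add, Real.rpow_add ht0, Real.rpow_neg ht0.le 2]
      norm_cast
      field_simp
    rw [h1, ← mul_assoc]
    gcongr
    exact abs_psiErrorPrimitive_le (mem_Ioi.mp ht).le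

theorem integral_psiErrorPrimitive_mul_cpow {z : ℂ} (hz : 1 < z.re) :
    ∫ t in Ioi (1 : ℝ), (psiErrorPrimitive t : ℂ) * (t : ℂ) ^ (-(z + 2)) =
      psiErrorTransform z := by
  have hz0 : z ≠ 0 := by rintro rfl; simp at hz; linarith
  have hz1 : z + 1 ≠ 0 := by
    intro h
    have := congrArg re h
    rw [add_re, one_re, zero_re] at this
    linarith
  have hderiv : ∀ t : ℝ, 0 < t → HasDerivAt (fun t : ℝ ↦ (t : ℂ) ^ (-(z + 1)))
      (-(z + 1) * (t : ℂ) ^ (-(z + 2))) t := by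
    intro t ht
    have := hasDerivAt_ofReal_cpow_const' ht.ne' (r := -(z + 2)) (by
      intro h; apply hz1; linear_combination -h)
    have h2 := this.const_mul (-(z + 1))
    have e : -(z + 2) + 1 = -(z + 1) := by ring
    rw [e] at h2
    convert! h2 using 2 with y
    field_simp
  have hcont : ∀ w : ℂ, ∀ X : ℝ, 1 ≤ X → ContinuousOn (fun t : ℝ ↦ (t : ℂ) ^ w) (uIcc 1 X) := by
    intro w X hX
    rw [uIcc_of_le hX]
    intro t ht
    exact (continuousAt_ofReal_cpow_const t w
      (Or.inr (by linarith [ht.1]))).continuousWithinAt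
  have hparts : ∀ X : ℝ, 1 ≤ X →
      ∫ t in (1 : ℝ)..X, (psiErrorPrimitive t : ℂ) * (-(z + 1) * (t : ℂ) ^ (-(z + 2))) =
        (psiErrorPrimitive X : ℂ) * (X : ℂ) ^ (-(z + 1)) -
        ∫ t in (1 : ℝ)..X, (psiError t : ℂ) * (t : ℂ) ^ (-(z + 1)) := by
    intro X hX
    rw [intervalIntegral.integral_mul_deriv_eq_deriv_mul_of_hasDeriv_right
      (u := fun t ↦ (psiErrorPrimitive t : ℂ)) (v := fun t : ℝ ↦ (t : ℂ) ^ (-(z + 1)))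
      (u' := fun t ↦ (psiError t : ℂ)) (v' := fun t : ℝ ↦ (-(z + 1) * (t : ℂ) ^ (-(z + 2))))]
    · simp [psiErrorPrimitive]
    · exact (continuous_ofReal.comp continuous_psiErrorPrimitive).continuousOn
    · exact hcont _ X hX
    · intro t ht
      rw [min_eq_left hX] at ht
      exact (hasDerivWithinAt_psiErrorPrimitive (by linarith [ht.1])).ofReal_comp
    · intro t ht
      rw [min_eq_left hX] at ht
      exact (hderiv t (by linarith [ht.1])).hasDerivWithinAt
    · have h := intervalIntegrable_psiError 1 X
      exact ⟨h.1.ofReal, h.2.ofReal⟩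
    · exact (ContinuousOn.const_mul (hcont _ X hX) _).intervalIntegrable
  have hlim0 : Tendsto (fun X : ℝ ↦ (psiErrorPrimitive X : ℂ) * (X : ℂ) ^ (-(z + 1))) atTop
      (𝓝 0) := by
    refine squeeze_zero_norm' (a := fun X : ℝ ↦ 6 * X ^ (-(z.re - 1))) ?_ ?_
    · filter_upwards [eventually_ge_atTop 1] with X hX
      have hX0 : 0 < X := by linarith
      rw [norm_mul, norm_cpow_eq_rpow_re_of_pos hX0, norm_real]
      have h1 : X ^ (-(z.re - 1)) = X ^ 2 * X ^ (-(z + 1)).re := by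
        rw [← Real.rpow_natCast X 2, ← Real.rpow_add hX0]
        congr 1
        simp
        ring
      rw [h1, ← mul_assoc]
      gcongr
      exact abs_psiErrorPrimitive_le hX
    · simpa using (tendsto_rpow_neg_atTop (y := z.re - 1) (by linarith)).const_mul 6
  have hint := (integrableOn_psiErrorPrimitive_mul_cpow hz).const_mul (-(z + 1))
  have hL := intervalIntegral_tendsto_integral_Ioi 1 hint tendsto_id
  have hR := hlim0.sub (intervalIntegral_tendsto_integral_Ioi 1
    (integrableOn_psiError_mul_cpow hz) tendsto_id)
  have heq := tendsto_nhds_unique (hL.congr' ?_) hR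
  · rw [integral_const_mul, integral_psiError_mul_cpow hz] at heq
    rw [psiErrorTransform]
    field_simp
    field_simp at heq
    linear_combination -heq
  · filter_upwards [eventually_ge_atTop 1] with X hX
    rw [id, ← hparts X hX]
    refine intervalIntegral.integral_congr fun t _ ↦ ?_
    ring

theorem one_add_sq_le_norm_mul {z : ℂ} (hz : 1 ≤ z.re) : 1 + z.im ^ 2 ≤ ‖z * (z + 1)‖ := by
  have h1 : 1 + z.im ^ 2 ≤ ‖z‖ ^ 2 := by
    rw [← normSq_eq_norm_sq, normSq_apply]; nlinarith
  have h2 : ‖z‖ ≤ ‖z + 1‖ := by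
    rw [← sq_le_sq₀ (norm_nonneg _) (norm_nonneg _), ← normSq_eq_norm_sq, ← normSq_eq_norm_sq,
      normSq_apply, normSq_apply, add_re, add_im, one_re, one_im]
    nlinarith
  rw [norm_mul]
  nlinarith [norm_nonneg z]

theorem differentiableAt_psiErrorTransform {z : ℂ} (hz : 0 < z.re) (h0 : riemannZeta₁ z ≠ 0) :
    DifferentiableAt ℂ psiErrorTransform z := by
  have hz0 : z ≠ 0 := by rintro rfl; simp at hz
  have hz1 : z + 1 ≠ 0 := by
    intro h
    have := congrArg re h
    rw [add_re, one_re, zero_re] at this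
    linarith
  unfold psiErrorTransform
  have := differentiable_riemannZeta₁.deriv z
  have := differentiable_riemannZeta₁ z
  fun_prop (disch := first | assumption | exact mul_ne_zero hz0 hz1)

theorem exists_norm_psiErrorTransform_le_div :
    ∃ C : ℝ, 0 < C ∧ ∀ z : ℂ, 1 < z.re → z.re ≤ 2 →
      ‖psiErrorTransform z‖ ≤ C / (z.re - 1) * (1 + z.im ^ 2)⁻¹ := by
  obtain ⟨C, hC, h⟩ := exists_norm_logDeriv_riemannZeta₁_le_div
  refine ⟨C + 1, by positivity, fun z h1 h2 ↦ ?_⟩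
  have hd : 0 < z.re - 1 := by linarith
  have h3 := one_add_sq_le_norm_mul h1.le
  have h4 : ‖-(deriv riemannZeta₁ z / riemannZeta₁ z) - 1‖ ≤ (C + 1) / (z.re - 1) := by
    have h5 := norm_sub_le (-(deriv riemannZeta₁ z / riemannZeta₁ z)) 1
    rw [norm_neg, norm_one] at h5
    have h6 := h z h1 h2
    have h7 : 1 ≤ 1 / (z.re - 1) := by rw [le_div_iff₀ hd]; linarith
    rw [add_div]
    linarith
  rw [psiErrorTransform, norm_div, ← div_eq_mul_inv]
  gcongr

theorem integrable_cpow_mul_psiErrorTransform {x σ : ℝ} (hx : 0 < x) (h1 : 1 < σ) (h2 : σ ≤ 2) :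
    Integrable fun y : ℝ ↦ (x : ℂ) ^ (σ + y * I + 1) * psiErrorTransform (σ + y * I) := by
  obtain ⟨C, hC, h⟩ := exists_norm_psiErrorTransform_le_div
  have hxc : (x : ℂ) ≠ 0 := by exact_mod_cast hx.ne'
  refine Integrable.mono' (integrable_inv_one_add_sq.const_mul (x ^ (σ + 1) * (C / (σ - 1)))) ?_ ?_
  · refine Continuous.aestronglyMeasurable (Continuous.mul ?_ ?_)
    · exact continuous_const.cpow (by fun_prop) fun y ↦ by left; simpa using hx
    · rw [continuous_iff_continuousAt]
      intro y
      have : ContinuousAt psiErrorTransform (σ + y * I) :=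
        (differentiableAt_psiErrorTransform (by simp; linarith)
          (riemannZeta₁_ne_zero_of_one_le_re (by simpa using h1.le))).continuousAt
      exact ContinuousAt.comp (f := fun y : ℝ ↦ (σ : ℂ) + y * I) this (by fun_prop)
  · refine Eventually.of_forall fun y ↦ ?_
    have h3 := h (σ + y * I) (by simpa using h1) (by simpa using h2)
    rw [norm_mul, norm_cpow_eq_rpow_re_of_pos hx, mul_assoc]
    simp only [add_re, add_im, ofReal_re, ofReal_im, mul_re, mul_im, I_re, I_im, mul_zero, mul_one,
      sub_zero, add_zero, zero_add, one_re] at h3 ⊢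
    gcongr

/-- A smoothed form of the explicit formula. -/
theorem psiErrorPrimitive_eq_integral {x σ : ℝ} (hx : 1 < x) (h1 : 1 < σ) (h2 : σ ≤ 2) :
    (psiErrorPrimitive x : ℂ) = (1 / (2 * Real.pi)) • ∫ y : ℝ,
      (x : ℂ) ^ (σ + y * I + 1) * psiErrorTransform (σ + y * I) := by
  have hx0 : 0 < x := by linarith
  set f : ℝ → ℂ := (Ioi 1).indicator fun t ↦ (psiErrorPrimitive t : ℂ) with hf
  have hmul : ∀ z : ℂ, (fun t : ℝ ↦ (t : ℂ) ^ (-(z + 1) - 1) • f t) =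
      (Ioi (1 : ℝ)).indicator (fun t : ℝ ↦ (psiErrorPrimitive t : ℂ) * (t : ℂ) ^ (-(z + 2))) := by
    intro z
    ext t
    have e : -(z + 1) - 1 = -(z + 2) := by ring
    by_cases ht : t ∈ Ioi (1 : ℝ)
    · rw [hf, indicator_of_mem ht, indicator_of_mem ht, smul_eq_mul, mul_comm, e]
    · rw [hf, indicator_of_notMem ht, indicator_of_notMem ht, smul_zero]
  have hsub : Ioi (0 : ℝ) ∩ Ioi 1 = Ioi 1 := inter_eq_self_of_subset_right (Ioi_subset_Ioi zero_le_one)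
  have hmel : ∀ z : ℂ, 1 < z.re → mellin f (-(z + 1)) = psiErrorTransform z := by
    intro z hz
    rw [mellin, hmul, setIntegral_indicator measurableSet_Ioi, hsub,
      integral_psiErrorPrimitive_mul_cpow hz]
  have hconv : MellinConvergent f ((-(σ + 1) : ℝ) : ℂ) := by
    rw [MellinConvergent]
    have e : ((-(σ + 1) : ℝ) : ℂ) = -((σ : ℂ) + 1) := by push_cast; ring
    rw [e, hmul]
    exact (integrable_indicator_iff measurableSet_Ioi).mpr
      (integrableOn_psiErrorPrimitive_mul_cpow (by simpa using h1)) |>.integrableOn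
  have hline : ∀ y : ℝ, mellin f (((-(σ + 1) : ℝ) : ℂ) + y * I) =
      psiErrorTransform (σ + ((-y : ℝ) : ℂ) * I) := by
    intro y
    rw [← hmel _ (by simpa using h1)]
    congr 1
    push_cast
    ring
  have hvert : VerticalIntegrable (mellin f) (-(σ + 1)) := by
    have h3 := integrable_cpow_mul_psiErrorTransform one_pos h1 h2
    simp only [ofReal_one, one_cpow, one_mul] at h3
    rw [VerticalIntegrable]
    simp only [hline]
    exact h3.comp_neg
  have hcont : ContinuousAt f x := by
    refine ContinuousAt.congr (f := fun t ↦ (psiErrorPrimitive t : ℂ))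
      (continuous_ofReal.comp continuous_psiErrorPrimitive).continuousAt ?_
    filter_upwards [Ioi_mem_nhds hx] with t ht
    rw [hf, indicator_of_mem ht]
  have hinv := mellinInv_mellin_eq (-(σ + 1)) f hx0 hconv hvert hcont
  rw [hf, indicator_of_mem (mem_Ioi.mpr hx), ← hf] at hinv
  rw [← hinv, mellinInv]
  congr 1
  rw [← integral_neg_eq_self]
  refine integral_congr_ae (Eventually.of_forall fun y ↦ ?_)
  simp only [hline, smul_eq_mul, neg_neg]
  congr 2
  push_cast
  ring

theorem integral_Ioi_inv_one_add_sq_le {T : ℝ} (hT : 0 < T) :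
    ∫ y in Ioi T, (1 + y ^ 2)⁻¹ ≤ 1 / T := by
  have h1 : ∫ y in Ioi T, y ^ (-2 : ℝ) = 1 / T := by
    rw [integral_Ioi_rpow_of_lt (by norm_num) hT]
    norm_num [Real.rpow_neg_one]
  rw [← h1]
  refine setIntegral_mono_on integrable_inv_one_add_sq.integrableOn
    (integrableOn_Ioi_rpow_of_lt (by norm_num) hT) measurableSet_Ioi fun y hy ↦ ?_
  have hy0 : 0 < y := hT.trans (mem_Ioi.mp hy)
  rw [Real.rpow_neg hy0.le, Real.rpow_two]
  gcongr
  linarith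

theorem exists_psiErrorPrimitive_contour_bound :
    ∃ C : ℝ, 0 < C ∧ ∀ x σ₁ σ₀ T B : ℝ, 1 < x → 9 / 10 ≤ σ₁ → σ₁ ≤ 1 → 1 < σ₀ → σ₀ ≤ 2 → 1 ≤ T →
      1 ≤ B → (∀ z : ℂ, σ₁ ≤ z.re → z.re ≤ 2 → |z.im| ≤ T → riemannZeta₁ z ≠ 0 ∧
        ‖deriv riemannZeta₁ z / riemannZeta₁ z‖ ≤ B) →
      |psiErrorPrimitive x| ≤ C * (x ^ (σ₁ + 1) * B + x ^ (σ₀ + 1) * B / T ^ 2 +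
        x ^ (σ₀ + 1) / ((σ₀ - 1) * T)) := by
  obtain ⟨C₀, hC0, hdec⟩ := exists_norm_psiErrorTransform_le_div
  refine ⟨2 * C₀ + 64, by positivity, fun x σ₁ σ₀ T B hx h1 h1' h0 h0' hT hB hZ ↦ ?_⟩
  have hx0 : 0 < x := by linarith
  have hxc : (x : ℂ) ≠ 0 := by exact_mod_cast hx0.ne'
  have hT0 : 0 < T := by linarith
  set F : ℂ → ℂ := fun z ↦ (x : ℂ) ^ (z + 1) * psiErrorTransform z with hF
  have hFd : ∀ z : ℂ, σ₁ ≤ z.re → z.re ≤ 2 → |z.im| ≤ T → DifferentiableAt ℂ F z := by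
    intro z hz1 hz2 hz3
    refine DifferentiableAt.mul ?_ (differentiableAt_psiErrorTransform (by linarith) (hZ z hz1 hz2 hz3).1)
    exact (differentiableAt_id.add_const 1).const_cpow (Or.inl hxc)
  have hFb : ∀ z : ℂ, σ₁ ≤ z.re → z.re ≤ 2 → |z.im| ≤ T →
      ‖F z‖ ≤ 4 * x ^ (z.re + 1) * B * (1 + z.im ^ 2)⁻¹ := by
    intro z hz1 hz2 hz3
    have h3 := (hZ z hz1 hz2 hz3).2
    have h4 : ‖-(deriv riemannZeta₁ z / riemannZeta₁ z) - 1‖ ≤ 2 * B := by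
      have h5 := norm_sub_le (-(deriv riemannZeta₁ z / riemannZeta₁ z)) 1
      rw [norm_neg, norm_one] at h5
      linarith
    have h6 : (1 + z.im ^ 2) / 2 ≤ ‖z * (z + 1)‖ := by
      have h1 : (1 + z.im ^ 2) / 2 ≤ ‖z‖ ^ 2 := by
        rw [← normSq_eq_norm_sq, normSq_apply]; nlinarith
      have h2 : ‖z‖ ≤ ‖z + 1‖ := by
        rw [← sq_le_sq₀ (norm_nonneg _) (norm_nonneg _), ← normSq_eq_norm_sq, ← normSq_eq_norm_sq,
          normSq_apply, normSq_apply, add_re, add_im, one_re, one_im]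
        nlinarith
      rw [norm_mul]
      nlinarith [norm_nonneg z]
    rw [hF]
    simp only [psiErrorTransform]
    rw [norm_mul, norm_cpow_eq_rpow_re_of_pos hx0, add_re, one_re, norm_div]
    have h7 : ‖-(deriv riemannZeta₁ z / riemannZeta₁ z) - 1‖ / ‖z * (z + 1)‖ ≤
        2 * B / ((1 + z.im ^ 2) / 2) := by gcongr
    calc _ ≤ x ^ (z.re + 1) * (2 * B / ((1 + z.im ^ 2) / 2)) := by gcongr
      _ = _ := by field_simp; norm_num
  have hline : ∀ σ y : ℝ, ((σ : ℂ) + y * I).re = σ ∧ ((σ : ℂ) + y * I).im = y := by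
    intro σ y; simp
  have hrect := integral_boundary_rect_eq_zero_of_differentiableOn F
    ((σ₁ : ℂ) + ((-T : ℝ) : ℂ) * I) ((σ₀ : ℂ) + (T : ℂ) * I) (by
      intro z hz
      rw [mem_reProdIm, (hline _ _).1, (hline _ _).1, (hline _ _).2, (hline _ _).2,
        uIcc_of_le (by linarith), uIcc_of_le (by linarith)] at hz
      exact (hFd z hz.1.1 (hz.1.2.trans h0') (abs_le.mpr hz.2)).differentiableWithinAt)
  simp only [(hline _ _).1, (hline _ _).2] at hrect
  set A₁ := ∫ u in σ₁..σ₀, F (u + ((-T : ℝ) : ℂ) * I) with hA1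
  set A₂ := ∫ u in σ₁..σ₀, F (u + (T : ℂ) * I) with hA2
  set R := ∫ y in (-T)..T, F (σ₀ + y * I) with hR
  set Lf := ∫ y in (-T)..T, F (σ₁ + y * I) with hLf
  have hhor : ∀ τ : ℝ, |τ| = T → ‖∫ u in σ₁..σ₀, F (u + (τ : ℂ) * I)‖ ≤
      8 * (x ^ (σ₀ + 1) * B / T ^ 2) := by
    intro τ hτ
    have h := intervalIntegral.norm_integral_le_of_norm_le_const (a := σ₁) (b := σ₀)
      (C := 4 * (x ^ (σ₀ + 1) * B / T ^ 2))
      (f := fun u : ℝ ↦ F (u + (τ : ℂ) * I)) fun u hu ↦ by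
        rw [uIoc_of_le (by linarith)] at hu
        have h := hFb (u + (τ : ℂ) * I) (by rw [(hline _ _).1]; exact hu.1.le)
          (by rw [(hline _ _).1]; exact hu.2.trans h0') (by rw [(hline _ _).2]; exact hτ.le)
        rw [(hline _ _).1, (hline _ _).2] at h
        refine h.trans ?_
        have h3 : τ ^ 2 = T ^ 2 := by rw [← hτ, sq_abs]
        rw [h3]
        have h4 : (1 + T ^ 2)⁻¹ ≤ (T ^ 2)⁻¹ := by gcongr; linarith
        have h5 : x ^ (u + 1) ≤ x ^ (σ₀ + 1) :=
          Real.rpow_le_rpow_of_exponent_le hx.le (by linarith [hu.2])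
        calc 4 * x ^ (u + 1) * B * (1 + T ^ 2)⁻¹ ≤ 4 * x ^ (σ₀ + 1) * B * (T ^ 2)⁻¹ := by gcongr
          _ = _ := by ring
    refine h.trans ?_
    have h6 : |σ₀ - σ₁| ≤ 2 := by rw [abs_le]; constructor <;> linarith
    have h7 : 0 ≤ 4 * (x ^ (σ₀ + 1) * B / T ^ 2) := by positivity
    nlinarith
  have hA1b := hhor (-T) (by rw [abs_neg, abs_of_pos hT0])
  have hA2b := hhor T (abs_of_pos hT0)
  have hLb : ‖Lf‖ ≤ 16 * (x ^ (σ₁ + 1) * B) := by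
    have h2 : ‖Lf‖ ≤ ∫ y in (-T)..T, 4 * x ^ (σ₁ + 1) * B * (1 + y ^ 2)⁻¹ := by
      refine intervalIntegral.norm_integral_le_of_norm_le (by linarith) ?_ ?_
      · refine Eventually.of_forall fun y hy ↦ ?_
        have h := hFb (σ₁ + y * I) (by rw [(hline _ _).1])
          (by rw [(hline _ _).1]; linarith) (by rw [(hline _ _).2, abs_le]; exact ⟨hy.1.le, hy.2⟩)
        rwa [(hline _ _).1, (hline _ _).2] at h
      · exact (integrable_inv_one_add_sq.const_mul _).intervalIntegrable
    rw [intervalIntegral.integral_const_mul] at h2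
    have h3 : ∫ y in (-T)..T, (1 + y ^ 2)⁻¹ ≤ Real.pi := by
      rw [intervalIntegral.integral_of_le (by linarith), ← integral_univ_inv_one_add_sq]
      exact setIntegral_le_integral integrable_inv_one_add_sq
        (Eventually.of_forall fun y ↦ by positivity)
    have h4 := Real.pi_le_four
    have h5 : 0 ≤ 4 * x ^ (σ₁ + 1) * B := by positivity
    nlinarith
  have hint := integrable_cpow_mul_psiErrorTransform hx0 h0 h0'
  have hFline : (fun y : ℝ ↦ (x : ℂ) ^ ((σ₀ : ℂ) + y * I + 1) * psiErrorTransform (σ₀ + y * I)) =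
      fun y : ℝ ↦ F (σ₀ + y * I) := rfl
  rw [hFline] at hint
  have htail_bound : ∀ y : ℝ, ‖F (σ₀ + y * I)‖ ≤ x ^ (σ₀ + 1) * (C₀ / (σ₀ - 1)) * (1 + y ^ 2)⁻¹ := by
    intro y
    have h := hdec (σ₀ + y * I) (by rwa [(hline _ _).1]) (by rwa [(hline _ _).1])
    rw [(hline _ _).1, (hline _ _).2] at h
    rw [hF]
    simp only
    rw [norm_mul, norm_cpow_eq_rpow_re_of_pos hx0, add_re, one_re, (hline _ _).1, mul_assoc]
    gcongr
  have hKpos : 0 ≤ x ^ (σ₀ + 1) * (C₀ / (σ₀ - 1)) := by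
    have : 0 < σ₀ - 1 := by linarith
    positivity
  have htail1 : ‖∫ y in Ioi T, F (σ₀ + y * I)‖ ≤ x ^ (σ₀ + 1) * (C₀ / (σ₀ - 1)) * (1 / T) := by
    refine (norm_integral_le_of_norm_le (integrable_inv_one_add_sq.integrableOn.const_mul
      (x ^ (σ₀ + 1) * (C₀ / (σ₀ - 1)))) (Eventually.of_forall htail_bound)).trans ?_
    rw [integral_const_mul]
    gcongr
    exact integral_Ioi_inv_one_add_sq_le hT0
  have htail2 : ‖∫ y in Iic (-T), F (σ₀ + y * I)‖ ≤ x ^ (σ₀ + 1) * (C₀ / (σ₀ - 1)) * (1 / T) := by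
    rw [← integral_comp_neg_Ioi]
    refine (norm_integral_le_of_norm_le (integrable_inv_one_add_sq.integrableOn.const_mul
      (x ^ (σ₀ + 1) * (C₀ / (σ₀ - 1)))) (Eventually.of_forall fun y ↦ ?_)).trans ?_
    · simpa using htail_bound (-y)
    · rw [integral_const_mul]
      gcongr
      exact integral_Ioi_inv_one_add_sq_le hT0
  have hsplit : ∫ y : ℝ, F (σ₀ + y * I) =
      (∫ y in Iic (-T), F (σ₀ + y * I)) + R + ∫ y in Ioi T, F (σ₀ + y * I) := by
    rw [hR, intervalIntegral.integral_of_le (by linarith),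
      ← setIntegral_union _ measurableSet_Ioc hint.integrableOn hint.integrableOn,
      Iic_union_Ioc_eq_Iic (by linarith),
      ← setIntegral_union _ measurableSet_Ioi hint.integrableOn hint.integrableOn,
      Iic_union_Ioi, setIntegral_univ]
    · exact Iic_disjoint_Ioi le_rfl
    · exact Iic_disjoint_Ioc le_rfl
  have hRb : ‖R‖ ≤ ‖Lf‖ + ‖A₁‖ + ‖A₂‖ := by
    have h2 : I * R = I * Lf + A₂ - A₁ := by
      simp only [smul_eq_mul] at hrect
      linear_combination hrect
    calc ‖R‖ = ‖I * R‖ := by simp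
      _ ≤ ‖I * Lf‖ + ‖A₂‖ + ‖A₁‖ := by
        rw [h2]; exact (norm_sub_le _ _).trans (by gcongr; exact norm_add_le _ _)
      _ = _ := by rw [norm_mul, norm_I]; ring
  have hform := psiErrorPrimitive_eq_integral hx h0 h0'
  rw [hFline, hsplit] at hform
  have hnorm : |psiErrorPrimitive x| ≤ ‖∫ y in Iic (-T), F (σ₀ + y * I)‖ + ‖R‖ +
      ‖∫ y in Ioi T, F (σ₀ + y * I)‖ := by
    have h2 : |psiErrorPrimitive x| = ‖(psiErrorPrimitive x : ℂ)‖ := by simp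
    rw [h2, hform, norm_smul, Real.norm_of_nonneg (by positivity)]
    have h3 : 1 / (2 * Real.pi) ≤ 1 := by
      rw [div_le_one (by positivity)]
      linarith [Real.pi_gt_three]
    refine (mul_le_of_le_one_left (norm_nonneg _) h3).trans ?_
    exact (norm_add_le _ _).trans (by gcongr; exact norm_add_le _ _)
  have e : x ^ (σ₀ + 1) * (C₀ / (σ₀ - 1)) * (1 / T) = C₀ * (x ^ (σ₀ + 1) / ((σ₀ - 1) * T)) := by
    have : 0 < σ₀ - 1 := by linarith
    field_simp
  rw [e] at htail1 htail2
  have p1 : 0 ≤ x ^ (σ₁ + 1) * B := by positivity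
  have p2 : 0 ≤ x ^ (σ₀ + 1) * B / T ^ 2 := by positivity
  have p3 : 0 ≤ x ^ (σ₀ + 1) / ((σ₀ - 1) * T) := by
    have : 0 < σ₀ - 1 := by linarith
    positivity
  calc |psiErrorPrimitive x| ≤ 16 * (x ^ (σ₁ + 1) * B) + 16 * (x ^ (σ₀ + 1) * B / T ^ 2) +
        2 * C₀ * (x ^ (σ₀ + 1) / ((σ₀ - 1) * T)) := by linarith
    _ ≤ _ := by nlinarith

theorem sq_mul_exp_neg_le {a u : ℝ} (ha : 0 < a) (hu : 0 ≤ u) :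
    u ^ 2 * Real.exp (-a * u) ≤ 8 / a ^ 2 * Real.exp (-(a / 2) * u) := by
  have h := Real.quadratic_le_exp_of_nonneg (x := a / 2 * u) (by positivity)
  have h1 : u ^ 2 ≤ 8 / a ^ 2 * Real.exp (a / 2 * u) := by
    have h2 : (a / 2 * u) ^ 2 / 2 ≤ Real.exp (a / 2 * u) := by
      have : 0 ≤ a / 2 * u := by positivity
      linarith
    calc u ^ 2 = 8 / a ^ 2 * ((a / 2 * u) ^ 2 / 2) := by field_simp; ring
      _ ≤ _ := by gcongr
  calc u ^ 2 * Real.exp (-a * u) ≤ 8 / a ^ 2 * Real.exp (a / 2 * u) * Real.exp (-a * u) := by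
        gcongr
    _ = _ := by rw [mul_assoc, ← Real.exp_add]; ring_nf

theorem exists_abs_psiErrorPrimitive_le : ∃ c C : ℝ, 0 < c ∧ c ≤ 1 ∧ 0 < C ∧ ∀ x : ℝ, 1 ≤ x →
    |psiErrorPrimitive x| ≤ C * x ^ 2 * Real.exp (-c * √(Real.log x)) := by
  obtain ⟨c, C, hc, hc1, hC, h⟩ := exists_norm_logDeriv_riemannZeta₁_le
  obtain ⟨K, hK, hb⟩ := exists_psiErrorPrimitive_contour_bound
  set a := c / 3 with ha
  have ha0 : 0 < a := by positivity
  set A := 9 * C + 1 with hA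
  have hA0 : 0 < A := by positivity
  have he : 0 < Real.exp 1 := Real.exp_pos 1
  refine ⟨a / 2, K * (A + Real.exp 1 * A + Real.exp 1) * (8 / a ^ 2) + 6 * Real.exp 1,
    by positivity, by linarith, by positivity, fun x hx ↦ ?_⟩
  have hL0 : 0 ≤ Real.log x := Real.log_nonneg hx
  have hx0 : 0 < x := by linarith
  set u := √(Real.log x) with hu
  have hu0 : 0 ≤ u := Real.sqrt_nonneg _
  have hu2 : u ^ 2 = Real.log x := Real.sq_sqrt hL0
  rcases lt_or_ge u 1 with hu1 | hu1
  · have h1 : 1 ≤ Real.exp 1 * Real.exp (-(a / 2) * u) := by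
      rw [← Real.exp_add]
      apply Real.one_le_exp
      nlinarith
    calc |psiErrorPrimitive x| ≤ 6 * x ^ 2 * 1 := by simpa using abs_psiErrorPrimitive_le hx
      _ ≤ 6 * x ^ 2 * (Real.exp 1 * Real.exp (-(a / 2) * u)) := by gcongr
      _ = 6 * Real.exp 1 * x ^ 2 * Real.exp (-(a / 2) * u) := by ring
      _ ≤ _ := by
        gcongr
        have : 0 ≤ K * (A + Real.exp 1 * A + Real.exp 1) * (8 / a ^ 2) := by positivity
        linarith
  · have hT : 1 ≤ Real.exp u := Real.one_le_exp hu0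
    have hT2 : 2 ≤ Real.exp u := by linarith [Real.add_one_le_exp u]
    have hlog : ∀ t : ℝ, |t| ≤ Real.exp u → Real.log (|t| + 3) ≤ 3 * u := by
      intro t ht
      rw [Real.log_le_iff_le_exp (by positivity)]
      have : Real.exp (3 * u) = Real.exp u ^ 3 := by rw [← Real.exp_nat_mul]; norm_num
      rw [this]
      nlinarith [mul_nonneg (sub_nonneg.2 hT2) (sub_nonneg.2 hT2), sq_nonneg (Real.exp u)]
    have hx1 : 1 < x := by
      rcases hx.lt_or_eq with h | h
      · exact h
      · rw [← h] at hu2; simp at hu2; linarith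
    have hpow : ∀ y : ℝ, x ^ y = Real.exp (u ^ 2 * y) := fun y ↦ by
      rw [hu2, Real.rpow_def_of_pos hx0]
    have key := hb x (1 - c / (3 * u)) (1 + 1 / u ^ 2) (Real.exp u) (A * u ^ 2) hx1
      (by
        have : c / (3 * u) ≤ c / 1 := by gcongr; linarith
        linarith)
      (by have : 0 ≤ c / (3 * u) := by positivity
          linarith)
      (by have : 0 < 1 / u ^ 2 := by positivity
          linarith)
      (by have : 1 / u ^ 2 ≤ 1 := by rw [div_le_one (by positivity)]; nlinarith
          linarith) hT (by nlinarith) (by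
        intro z hz hz2 hzT
        have h1 := one_le_log_abs_add_three z.im
        have h2 := hlog z.im hzT
        obtain ⟨hne, hle⟩ := h z (by
          have : c / (3 * u) ≤ c / Real.log (|z.im| + 3) := by gcongr
          linarith) hz2
        refine ⟨hne, hle.trans ?_⟩
        calc C * Real.log (|z.im| + 3) ^ 2 ≤ C * (3 * u) ^ 2 := by gcongr
          _ ≤ A * u ^ 2 := by rw [hA]; nlinarith)
    have hx2 : x ^ 2 = Real.exp (u ^ 2 * 2) := by rw [← hpow]; norm_cast
    have e1 : x ^ (1 - c / (3 * u) + 1) = x ^ 2 * Real.exp (-a * u) := by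
      rw [hpow, hx2, ← Real.exp_add, ha]
      congr 1
      field_simp
      ring
    have e2 : x ^ (1 + 1 / u ^ 2 + 1) = x ^ 2 * Real.exp 1 := by
      rw [hpow, hx2, ← Real.exp_add]
      congr 1
      field_simp
      ring
    rw [e1, e2] at key
    have f1 : x ^ 2 * Real.exp 1 * (A * u ^ 2) / Real.exp u ^ 2
        ≤ x ^ 2 * Real.exp 1 * (A * u ^ 2) * Real.exp (-a * u) := by
      rw [div_eq_mul_inv]
      gcongr
      rw [← Real.exp_nat_mul, ← Real.exp_neg]
      apply Real.exp_le_exp.2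
      push_cast
      nlinarith
    have f2 : x ^ 2 * Real.exp 1 / ((1 + 1 / u ^ 2 - 1) * Real.exp u)
        ≤ x ^ 2 * Real.exp 1 * u ^ 2 * Real.exp (-a * u) := by
      have : x ^ 2 * Real.exp 1 / ((1 + 1 / u ^ 2 - 1) * Real.exp u)
        = x ^ 2 * Real.exp 1 * u ^ 2 * Real.exp (-u) := by
        rw [Real.exp_neg]; field_simp; ring
      rw [this]
      gcongr
      nlinarith
    calc |psiErrorPrimitive x| ≤ _ := key
      _ ≤ K * (x ^ 2 * Real.exp (-a * u) * (A * u ^ 2) +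
          x ^ 2 * Real.exp 1 * (A * u ^ 2) * Real.exp (-a * u) +
          x ^ 2 * Real.exp 1 * u ^ 2 * Real.exp (-a * u)) := by gcongr
      _ = K * (A + Real.exp 1 * A + Real.exp 1) * x ^ 2 * (u ^ 2 * Real.exp (-a * u)) := by ring
      _ ≤ K * (A + Real.exp 1 * A + Real.exp 1) * x ^ 2 *
          (8 / a ^ 2 * Real.exp (-(a / 2) * u)) := by
        gcongr ?_ * ?_
        exact sq_mul_exp_neg_le ha0 hu0
      _ = K * (A + Real.exp 1 * A + Real.exp 1) * (8 / a ^ 2) * x ^ 2 *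
          Real.exp (-(a / 2) * u) := by ring
      _ ≤ _ := by
        gcongr
        have : 0 ≤ 6 * Real.exp 1 := by positivity
        linarith

theorem psiErrorPrimitive_sub (a b : ℝ) :
    psiErrorPrimitive b - psiErrorPrimitive a = ∫ t in a..b, psiError t :=
  intervalIntegral.integral_interval_sub_left (intervalIntegrable_psiError _ _)
    (intervalIntegrable_psiError _ _)

theorem psiError_mul_le {x h : ℝ} (hh : 0 ≤ h) :
    psiError x * h ≤ psiErrorPrimitive (x + h) - psiErrorPrimitive x + h ^ 2 := by
  rw [psiErrorPrimitive_sub]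
  have : ∫ t in x..(x + h), (psiError x - h) ≤ ∫ t in x..(x + h), psiError t := by
    apply intervalIntegral.integral_mono_on (by linarith) (by simp)
      (intervalIntegrable_psiError _ _)
    intro t ht
    have := Chebyshev.psi_mono ht.1
    simp only [psiError]
    linarith [ht.2]
  simp only [intervalIntegral.integral_const, smul_eq_mul] at this
  linarith

theorem neg_psiError_mul_le {x h : ℝ} (hh : 0 ≤ h) :
    -psiError x * h ≤ psiErrorPrimitive (x - h) - psiErrorPrimitive x + h ^ 2 := by
  have h1 := psiErrorPrimitive_sub (x - h) x
  have : ∫ t in (x - h)..x, psiError t ≤ ∫ t in (x - h)..x, (psiError x + h) := by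
    apply intervalIntegral.integral_mono_on (by linarith)
      (intervalIntegrable_psiError _ _) (by simp)
    intro t ht
    have := Chebyshev.psi_mono ht.2
    simp only [psiError]
    linarith [ht.1]
  simp only [intervalIntegral.integral_const, smul_eq_mul] at this
  linarith

theorem exists_abs_psiError_le : ∃ c C : ℝ, 0 < c ∧ c ≤ 1 ∧ 0 < C ∧ ∀ x : ℝ, 1 ≤ x →
    |psiError x| ≤ C * x * Real.exp (-c * √(Real.log x)) := by
  obtain ⟨c, C, hc, hc1, hC, hD⟩ := exists_abs_psiErrorPrimitive_le
  have he : 0 < Real.exp 1 := Real.exp_pos 1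
  refine ⟨c / 2, 2 * C * (5 + Real.exp 1) + 1 + 6 * Real.exp 1, by positivity, by linarith,
    by positivity, fun x hx ↦ ?_⟩
  have hL0 : 0 ≤ Real.log x := Real.log_nonneg hx
  have hx0 : 0 < x := by linarith
  set u := √(Real.log x) with hu
  have hu0 : 0 ≤ u := Real.sqrt_nonneg _
  have hu2 : u ^ 2 = Real.log x := Real.sq_sqrt hL0
  have hlog2 : Real.log 2 ≤ 1 := by linarith [Real.log_two_lt_d9]
  rcases lt_or_ge x 2 with hx2 | hx2
  · have hu1 : u ≤ 1 := by
      rw [hu, Real.sqrt_le_one]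
      exact (Real.log_le_log hx0 hx2.le).trans hlog2
    have h1 : 1 ≤ Real.exp 1 * Real.exp (-(c / 2) * u) := by
      rw [← Real.exp_add]
      apply Real.one_le_exp
      nlinarith
    calc |psiError x| ≤ 6 * x * 1 := by simpa using abs_psiError_le hx0.le
      _ ≤ 6 * x * (Real.exp 1 * Real.exp (-(c / 2) * u)) := by gcongr
      _ = 6 * Real.exp 1 * x * Real.exp (-(c / 2) * u) := by ring
      _ ≤ _ := by
        gcongr
        have : 0 ≤ 2 * C * (5 + Real.exp 1) := by positivity
        linarith
  · set q := Real.exp (-(c / 2) * u) with hq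
    have hq0 : 0 < q := Real.exp_pos _
    have hq1 : q ≤ 1 := Real.exp_le_one_iff.2 (by nlinarith)
    have hqq : Real.exp (-c * u) = q ^ 2 := by
      rw [hq, ← Real.exp_nat_mul]
      congr 1
      push_cast
      ring
    set h := x / 2 * q with hh
    have hh0 : 0 < h := by positivity
    have hhx : h ≤ x / 2 := by nlinarith
    have d0 : |psiErrorPrimitive x| ≤ C * x ^ 2 * q ^ 2 := hqq ▸ hD x hx
    have d1 : |psiErrorPrimitive (x + h)| ≤ C * (4 * x ^ 2) * q ^ 2 := by
      refine (hD (x + h) (by linarith)).trans ?_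
      rw [← hqq]
      have h1 : u ≤ √(Real.log (x + h)) :=
        Real.sqrt_le_sqrt (Real.log_le_log hx0 (by linarith))
      have h2 : (x + h) ^ 2 ≤ 4 * x ^ 2 := by nlinarith
      gcongr ?_ * ?_ * Real.exp ?_
      nlinarith
    have d2 : |psiErrorPrimitive (x - h)| ≤ C * (x ^ 2 * Real.exp 1) * q ^ 2 := by
      refine (hD (x - h) (by linarith)).trans ?_
      have h1 : u ≤ √(Real.log (x - h)) + 1 := by
        have hl : Real.log (x / 2) ≤ Real.log (x - h) :=
          Real.log_le_log (by linarith) (by linarith)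
        rw [Real.log_div hx0.ne' two_ne_zero] at hl
        have hl0 : 0 ≤ Real.log (x - h) := Real.log_nonneg (by linarith)
        rw [hu, Real.sqrt_le_left (by positivity)]
        nlinarith [Real.sq_sqrt hl0, Real.sqrt_nonneg (Real.log (x - h))]
      calc C * (x - h) ^ 2 * Real.exp (-c * √(Real.log (x - h)))
          ≤ C * x ^ 2 * (Real.exp 1 * Real.exp (-c * u)) := by
            rw [← Real.exp_add]
            gcongr ?_ * ?_ ^ 2 * Real.exp ?_
            · linarith
            · linarith
            · nlinarith
        _ = _ := by rw [hqq]; ring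
    have key : |psiError x| * h ≤ C * (5 + Real.exp 1) * x ^ 2 * q ^ 2 + h ^ 2 := by
      have p1 := psiError_mul_le (x := x) hh0.le
      have p2 := neg_psiError_mul_le (x := x) hh0.le
      rw [abs_le] at d0 d1 d2
      have n1 : 0 ≤ C * x ^ 2 * q ^ 2 := by positivity
      have n2 : 0 ≤ C * (x ^ 2 * Real.exp 1) * q ^ 2 := by positivity
      rcases abs_cases (psiError x) with ⟨h1, -⟩ | ⟨h1, -⟩ <;> rw [h1] <;> linarith
    have e : C * (5 + Real.exp 1) * x ^ 2 * q ^ 2 + h ^ 2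
        = (2 * C * (5 + Real.exp 1) * x * q + h) * h := by rw [hh]; ring
    rw [e] at key
    calc |psiError x| ≤ 2 * C * (5 + Real.exp 1) * x * q + h := le_of_mul_le_mul_right key hh0
      _ ≤ (2 * C * (5 + Real.exp 1) + 1) * x * q := by
        have : 0 ≤ x * q := by positivity
        rw [hh]; linarith
      _ ≤ _ := by
        gcongr
        · linarith
        · linarith [Real.add_one_le_exp 1]

theorem sum_vonMangoldt_eq_psi (t : ℝ) :
    ∑ k ∈ Finset.Icc 0 ⌊t⌋₊, (ArithmeticFunction.vonMangoldt k : ℂ) = (Chebyshev.psi t : ℂ) := by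
  rw [Chebyshev.psi_eq_sum_Icc, ofReal_sum]

theorem continuousOn_ofReal_cpow_uIcc {x : ℝ} (hx : 1 ≤ x) (z : ℂ) :
    ContinuousOn (fun t : ℝ ↦ (t : ℂ) ^ z) (uIcc 1 x) := fun t ht ↦ by
  rw [uIcc_of_le hx] at ht
  exact (continuousAt_ofReal_cpow_const t z (Or.inr (by linarith [ht.1]))).continuousWithinAt

theorem intervalIntegrable_ofReal_psiError (a b : ℝ) :
    IntervalIntegrable (fun t ↦ (psiError t : ℂ)) volume a b :=
  ⟨(intervalIntegrable_psiError a b).1.ofReal, (intervalIntegrable_psiError a b).2.ofReal⟩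

theorem intervalIntegrable_psiError_mul_cpow {x : ℝ} (hx : 1 ≤ x) (z : ℂ) :
    IntervalIntegrable (fun t : ℝ ↦ (psiError t : ℂ) * (t : ℂ) ^ z) volume 1 x :=
  IntervalIntegrable.mul_continuousOn (intervalIntegrable_ofReal_psiError 1 x)
    (continuousOn_ofReal_cpow_uIcc hx z)

theorem sum_vonMangoldt_div_cpow_eq {x : ℝ} (hx : 1 ≤ x) {s : ℂ} (hs0 : s ≠ 0) (hs1 : s ≠ 1) :
    ∑ n ∈ Finset.Icc 1 ⌊x⌋₊, (ArithmeticFunction.vonMangoldt n : ℂ) / (n : ℂ) ^ s =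
      x ^ (1 - s) / (1 - s) - s / (1 - s) + psiError x * x ^ (-s) +
        s * ∫ t in (1 : ℝ)..x, (psiError t : ℂ) * (t : ℂ) ^ (-(s + 1)) := by
  have hx0 : (0 : ℝ) < x := by linarith
  have hd : ∀ t : ℝ, 0 < t → HasDerivAt (fun t : ℝ ↦ (t : ℂ) ^ (-s))
      (-s * (t : ℂ) ^ (-(s + 1))) t := fun t ht ↦ by
    convert! hasDerivAt_ofReal_cpow_const ht.ne' (neg_ne_zero.2 hs0) using 2
    ring_nf
  have hdI : ∀ t ∈ Icc 1 x, deriv (fun t : ℝ ↦ (t : ℂ) ^ (-s)) t = -s * (t : ℂ) ^ (-(s + 1)) :=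
    fun t ht ↦ (hd t (by linarith [ht.1])).deriv
  have key := sum_mul_eq_sub_integral_mul₀ (𝕜 := ℂ)
    (fun n ↦ (ArithmeticFunction.vonMangoldt n : ℂ)) (f := fun t : ℝ ↦ (t : ℂ) ^ (-s))
    (by simp) x (fun t ht ↦ (hd t (by linarith [ht.1])).differentiableAt)
    (by
      rw [integrableOn_congr_fun hdI measurableSet_Icc]
      refine ContinuousOn.integrableOn_Icc (continuousOn_const.mul ?_)
      rw [← uIcc_of_le hx]
      exact continuousOn_ofReal_cpow_uIcc hx _)
  simp only [sum_vonMangoldt_eq_psi] at key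
  have e1 : ∑ n ∈ Finset.Icc 1 ⌊x⌋₊, (ArithmeticFunction.vonMangoldt n : ℂ) / (n : ℂ) ^ s =
      ∑ k ∈ Finset.Icc 0 ⌊x⌋₊, ((k : ℝ) : ℂ) ^ (-s) * (ArithmeticFunction.vonMangoldt k : ℂ) := by
    rw [← Finset.sum_Ioc_add_eq_sum_Icc (Nat.zero_le _)]
    simp [← Finset.Icc_add_one_left_eq_Ioc, cpow_neg, div_eq_mul_inv, mul_comm]
  have e2 : ∫ t in Ioc 1 x, deriv (fun t : ℝ ↦ (t : ℂ) ^ (-s)) t * (Chebyshev.psi t : ℂ) =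
      ∫ t in (1 : ℝ)..x, (-s * (t : ℂ) ^ (-s) +
        -s * ((psiError t : ℂ) * (t : ℂ) ^ (-(s + 1)))) := by
    rw [intervalIntegral.integral_of_le hx]
    refine setIntegral_congr_fun measurableSet_Ioc fun t ht ↦ ?_
    have ht0 : (t : ℂ) ≠ 0 := ofReal_ne_zero.2 (by linarith [ht.1])
    simp only [psiError]
    rw [hdI t ⟨ht.1.le, ht.2⟩, neg_add, cpow_add _ _ ht0, cpow_neg_one, ofReal_sub]
    field_simp
    ring
  have e3 : ∫ t in (1 : ℝ)..x, (t : ℂ) ^ (-s) = (x ^ (1 - s) - 1) / (1 - s) := by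
    rw [integral_cpow (Or.inr ⟨by simpa using hs1, by
      rw [uIcc_of_le hx]; exact fun h ↦ by linarith [h.1]⟩)]
    simp [neg_add_eq_sub]
  rw [e1, key, e2, intervalIntegral.integral_add
    ((continuousOn_ofReal_cpow_uIcc hx _).intervalIntegrable.const_mul _)
    ((intervalIntegrable_psiError_mul_cpow hx _).const_mul _),
    intervalIntegral.integral_const_mul, intervalIntegral.integral_const_mul, e3]
  have e4 : (Chebyshev.psi x : ℂ) = x + psiError x := by simp [psiError]
  have hs1' : 1 - s ≠ 0 := sub_ne_zero.2 hs1.symm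
  rw [e4, sub_eq_add_neg (1 : ℂ) s, cpow_add _ _ (ofReal_ne_zero.2 hx0.ne'), cpow_one,
    ← sub_eq_add_neg]
  field_simp
  ring

theorem differentiable_integral_psiError_mul_cpow {x : ℝ} (hx : 1 ≤ x) :
    Differentiable ℂ fun s : ℂ ↦ ∫ t in (1 : ℝ)..x, (psiError t : ℂ) * (t : ℂ) ^ (-(s + 1)) := by
  set f : ℝ → ℂ := (Ioc 1 x).indicator fun t ↦ (psiError t : ℂ) with hf
  have hmel : ∀ s : ℂ, ∫ t in (1 : ℝ)..x, (psiError t : ℂ) * (t : ℂ) ^ (-(s + 1)) =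
      mellin f (-s) := by
    intro s
    rw [mellin, intervalIntegral.integral_of_le hx]
    have : ∀ t : ℝ, (t : ℂ) ^ (-s - 1) • f t =
        (Ioc 1 x).indicator (fun t : ℝ ↦ (psiError t : ℂ) * (t : ℂ) ^ (-(s + 1))) t := by
      intro t
      by_cases ht : t ∈ Ioc 1 x
      · simp only [hf, indicator_of_mem ht, smul_eq_mul]; ring_nf
      · simp [hf, indicator_of_notMem ht]
    simp_rw [this]
    rw [setIntegral_indicator measurableSet_Ioc, inter_eq_right.2]
    exact fun t ht ↦ lt_trans one_pos ht.1
  simp_rw [hmel]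
  have hint : Integrable f := by
    rw [hf, integrable_indicator_iff measurableSet_Ioc,
      ← intervalIntegrable_iff_integrableOn_Ioc_of_le hx]
    exact intervalIntegrable_ofReal_psiError 1 x
  intro s
  refine DifferentiableAt.comp (g := mellin f) s (mellin_differentiableAt_of_isBigO_rpow
    (a := (-s).re + 1) (b := (-s).re - 1) (hint.locallyIntegrable.locallyIntegrableOn _)
    (IsBigO.of_bound 0 ?_) (by linarith) (IsBigO.of_bound 0 ?_) (by linarith))
    differentiableAt_id.neg
  · filter_upwards [eventually_gt_atTop x] with t ht
    simp [hf, indicator_of_notMem (fun h : t ∈ Ioc 1 x ↦ not_lt.2 h.2 ht)]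
  · filter_upwards [nhdsWithin_le_nhds (Iio_mem_nhds one_pos)] with t ht
    simp [hf, indicator_of_notMem (fun h : t ∈ Ioc 1 x ↦ not_lt.2 h.1.le ht)]

/-- The part of `-∑_{n > x} Λ(n) n⁻ˢ` (continued to a neighbourhood of `s = 1`, main term removed)
that is analytic in `s`, namely everything but the boundary term `psiError x * x⁻ˢ`. -/
noncomputable def psiRemainder (x : ℝ) (s : ℂ) : ℂ :=
  s * (∫ t in (1 : ℝ)..x, (psiError t : ℂ) * (t : ℂ) ^ (-(s + 1))) + 1 +
    deriv riemannZeta₁ s / riemannZeta₁ s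

theorem sum_vonMangoldt_div_cpow_sub_add_eq {x : ℝ} (hx : 1 ≤ x) {s : ℂ} (hs0 : s ≠ 0)
    (hs1 : s ≠ 1) (hZ : riemannZeta₁ s ≠ 0) :
    (∑ n ∈ Finset.Icc 1 ⌊x⌋₊, (ArithmeticFunction.vonMangoldt n : ℂ) / (n : ℂ) ^ s) -
        x ^ (1 - s) / (1 - s) + deriv riemannZeta s / riemannZeta s =
      psiError x * x ^ (-s) + psiRemainder x s := by
  have h1 := neg_deriv_div_riemannZeta_eq hs1 hZ
  have h2 : deriv riemannZeta s / riemannZeta s =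
      deriv riemannZeta₁ s / riemannZeta₁ s + 1 / (1 - s) := by
    rw [neg_div] at h1
    rw [← neg_sub s 1, div_neg]
    linear_combination -h1
  have hs1' : 1 - s ≠ 0 := sub_ne_zero.2 hs1.symm
  rw [sum_vonMangoldt_div_cpow_eq hx hs0 hs1, h2, psiRemainder]
  have h3 : s / (1 - s) = 1 / (1 - s) - 1 := by field_simp; ring
  rw [h3]
  ring

theorem norm_cpow_mul_integral_psiError_le {x q : ℝ} (hx : 1 ≤ x) {s : ℂ}
    (h : ∀ t ∈ Ioc 1 x, |psiError t| / t * (x / t) ^ (s.re - 1) ≤ q) :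
    ‖(x : ℂ) ^ (s - 1) * ∫ t in (1 : ℝ)..x, (psiError t : ℂ) * (t : ℂ) ^ (-(s + 1))‖ ≤
      q * Real.log x := by
  have hx0 : 0 < x := by linarith
  have h0 : (0 : ℝ) ∉ uIcc 1 x := by rw [uIcc_of_le hx]; exact fun h ↦ by linarith [h.1]
  rw [← intervalIntegral.integral_const_mul]
  have e : ∫ t in (1 : ℝ)..x, q * t⁻¹ = q * Real.log x := by
    rw [intervalIntegral.integral_const_mul, integral_inv h0, div_one]
  rw [← e]
  refine intervalIntegral.norm_integral_le_of_norm_le hx (ae_of_all _ fun t ht ↦ ?_)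
    ((intervalIntegral.intervalIntegrable_inv (fun t ht h ↦ h0 (h ▸ ht))
      continuousOn_id).const_mul q)
  have ht0 : 0 < t := by linarith [ht.1]
  rw [norm_mul, norm_mul, norm_cpow_eq_rpow_re_of_pos hx0, norm_cpow_eq_rpow_re_of_pos ht0,
    norm_real, Real.norm_eq_abs]
  calc x ^ (s - 1).re * (|psiError t| * t ^ (-(s + 1)).re)
      = |psiError t| / t * (x / t) ^ (s.re - 1) * t⁻¹ := by
        rw [Real.div_rpow hx0.le ht0.le, Real.rpow_sub_one ht0.ne']
        simp only [sub_re, one_re, neg_re, add_re]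
        rw [Real.rpow_neg ht0.le, Real.rpow_add_one ht0.ne']
        field_simp
    _ ≤ q * t⁻¹ := by gcongr; exact h t ht

theorem norm_cpow_mul_psiRemainder_le {x q G Q : ℝ} (hx : 1 ≤ x) {s : ℂ} (hs : ‖s‖ ≤ 2)
    (h : ∀ t ∈ Ioc 1 x, |psiError t| / t * (x / t) ^ (s.re - 1) ≤ q)
    (hG : ‖1 + deriv riemannZeta₁ s / riemannZeta₁ s‖ ≤ G) (hQ : x ^ (s.re - 1) ≤ Q) :
    ‖(x : ℂ) ^ (s - 1) * psiRemainder x s‖ ≤ 2 * q * Real.log x + Q * G := by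
  have hx0 : 0 < x := by linarith
  have hL : 0 ≤ Real.log x := Real.log_nonneg hx
  have hQ0 : 0 ≤ Q := (Real.rpow_nonneg hx0.le _).trans hQ
  have h1 : ‖(x : ℂ) ^ (s - 1)‖ = x ^ (s.re - 1) := by
    rw [norm_cpow_eq_rpow_re_of_pos hx0]; simp
  rw [show (x : ℂ) ^ (s - 1) * psiRemainder x s =
      s * (x ^ (s - 1) * ∫ t in (1 : ℝ)..x, (psiError t : ℂ) * (t : ℂ) ^ (-(s + 1))) +
        x ^ (s - 1) * (1 + deriv riemannZeta₁ s / riemannZeta₁ s) by rw [psiRemainder]; ring]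
  refine (norm_add_le _ _).trans (add_le_add ?_ ?_)
  · rw [norm_mul, mul_assoc]
    have := norm_cpow_mul_integral_psiError_le hx h
    gcongr
  · rw [norm_mul, h1]
    gcongr

theorem norm_cpow_mul_psiRemainder_le_trivial {x G Q : ℝ} (hx : 1 ≤ x) {s : ℂ} (hs : ‖s‖ ≤ 2)
    (hG : ‖1 + deriv riemannZeta₁ s / riemannZeta₁ s‖ ≤ G) (hQ1 : 1 ≤ Q)
    (hQ : x ^ (s.re - 1) ≤ Q) :
    ‖(x : ℂ) ^ (s - 1) * psiRemainder x s‖ ≤ 2 * (6 * Q) * Real.log x + Q * G := by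
  refine norm_cpow_mul_psiRemainder_le hx hs (fun t ht ↦ ?_) hG hQ
  have ht0 : 0 < t := by linarith [ht.1]
  have h1 : 1 ≤ x / t := by rw [one_le_div ht0]; exact ht.2
  have h2 : x / t ≤ x := div_le_self (by linarith) ht.1.le
  have h3 : (x / t) ^ (s.re - 1) ≤ Q := by
    rcases le_total 0 (s.re - 1) with h | h
    · exact (Real.rpow_le_rpow (by positivity) h2 h).trans hQ
    · exact (Real.rpow_le_one_of_one_le_of_nonpos h1 h).trans hQ1
  gcongr
  rw [div_le_iff₀ ht0]
  exact abs_psiError_le ht0.le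

theorem norm_cpow_mul_psiRemainder_le_left {c C x G : ℝ} (hc : 0 < c) (hC : 0 ≤ C)
    (hE : ∀ t : ℝ, 1 ≤ t → |psiError t| ≤ C * t * Real.exp (-c * √(Real.log t)))
    (hx : 1 ≤ x) {s : ℂ} (hs : ‖s‖ ≤ 2)
    (hG : ‖1 + deriv riemannZeta₁ s / riemannZeta₁ s‖ ≤ G)
    (hsc : c ≤ (1 - s.re) * √(Real.log x)) :
    ‖(x : ℂ) ^ (s - 1) * psiRemainder x s‖ ≤
      (2 * C * Real.log x + G) * Real.exp (-c * √(Real.log x)) := by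
  have hx0 : 0 < x := by linarith
  set u := √(Real.log x) with hu
  have hu0 : 0 ≤ u := Real.sqrt_nonneg _
  have hu2 : u ^ 2 = Real.log x := Real.sq_sqrt (Real.log_nonneg hx)
  have hpow : ∀ t : ℝ, 1 ≤ t → t ≤ x →
      (x / t) ^ (s.re - 1) ≤ Real.exp (-c * (u - √(Real.log t))) := by
    intro t ht htx
    have ht0 : 0 < t := by linarith
    set w := √(Real.log t) with hw
    have hw0 : 0 ≤ w := Real.sqrt_nonneg _
    have hw2 : w ^ 2 = Real.log t := Real.sq_sqrt (Real.log_nonneg ht)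
    have hwu : w ≤ u := Real.sqrt_le_sqrt (Real.log_le_log ht0 htx)
    rw [Real.rpow_def_of_pos (by positivity), Real.log_div hx0.ne' ht0.ne', ← hu2, ← hw2]
    apply Real.exp_le_exp.2
    have hs1 : 0 ≤ 1 - s.re := by
      by_contra! hneg
      have : u = 0 := by nlinarith
      rw [this, mul_zero] at hsc
      linarith
    nlinarith [mul_le_mul_of_nonneg_left hsc (sub_nonneg.2 hwu),
      mul_nonneg (mul_nonneg (sub_nonneg.2 hwu) hw0) hs1]
  have := norm_cpow_mul_psiRemainder_le (q := C * Real.exp (-c * u)) (G := G)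
    (Q := Real.exp (-c * u)) hx hs (fun t ht ↦ ?_) hG
    (by simpa using hpow 1 le_rfl hx)
  · refine this.trans (le_of_eq ?_)
    ring
  · have ht0 : 0 < t := by linarith [ht.1]
    have h1 : |psiError t| / t ≤ C * Real.exp (-c * √(Real.log t)) := by
      rw [div_le_iff₀ ht0]
      exact (hE t ht.1.le).trans (le_of_eq (by ring))
    calc |psiError t| / t * (x / t) ^ (s.re - 1)
        ≤ C * Real.exp (-c * √(Real.log t)) * Real.exp (-c * (u - √(Real.log t))) := by
          gcongr
          exact hpow t ht.1.le ht.2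
      _ = C * Real.exp (-c * u) := by
          rw [mul_assoc, ← Real.exp_add]
          ring_nf

theorem psiRemainder_eq_neg_integral_Ioi {x : ℝ} (hx : 1 ≤ x) {s : ℂ} (hs : 1 < s.re) :
    psiRemainder x s =
      -(s * ∫ t in Ioi x, (psiError t : ℂ) * (t : ℂ) ^ (-(s + 1))) := by
  have hs0 : s ≠ 0 := fun h ↦ by simp [h] at hs; linarith
  have h1 := integral_psiError_mul_cpow hs
  have hi := integrableOn_psiError_mul_cpow hs
  have h2 := intervalIntegral.integral_Ioi_sub_Ioi hi hx
  rw [h1] at h2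
  rw [psiRemainder, ← h2]
  field_simp
  ring

theorem norm_cpow_mul_psiRemainder_le_right {c C x : ℝ} (hc : 0 ≤ c) (hC : 0 ≤ C)
    (hE : ∀ t : ℝ, 1 ≤ t → |psiError t| ≤ C * t * Real.exp (-c * √(Real.log t)))
    (hx : 1 ≤ x) {s : ℂ} (hs : ‖s‖ ≤ 2) (hs1 : 1 < s.re)
    (hsL : 1 ≤ (s.re - 1) * Real.log x) :
    ‖(x : ℂ) ^ (s - 1) * psiRemainder x s‖ ≤
      2 * C * Real.log x * Real.exp (-c * √(Real.log x)) := by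
  have hx0 : 0 < x := by linarith
  set q := Real.exp (-c * √(Real.log x)) with hq
  have hs1' : 0 < s.re - 1 := by linarith
  have hint : ‖∫ t in Ioi x, (psiError t : ℂ) * (t : ℂ) ^ (-(s + 1))‖ ≤
      ∫ t in Ioi x, C * q * t ^ (-s.re) := by
    refine norm_integral_le_of_norm_le
      ((integrableOn_Ioi_rpow_of_lt (by linarith) hx0).const_mul _) ?_
    refine (ae_restrict_iff' measurableSet_Ioi).2 (ae_of_all _ fun t ht ↦ ?_)
    have hxt : x < t := ht
    have ht0 : 0 < t := by linarith
    rw [norm_mul, norm_cpow_eq_rpow_re_of_pos ht0, norm_real, Real.norm_eq_abs]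
    have h1 : |psiError t| ≤ C * t * q := by
      refine (hE t (by linarith)).trans ?_
      have : √(Real.log x) ≤ √(Real.log t) := Real.sqrt_le_sqrt (Real.log_le_log hx0 hxt.le)
      rw [hq]
      gcongr ?_ * Real.exp ?_
      nlinarith
    calc |psiError t| * t ^ (-(s + 1)).re ≤ C * t * q * t ^ (-(s + 1)).re := by gcongr
      _ = C * q * (t ^ (-(s + 1)).re * t) := by ring
      _ = C * q * t ^ (-s.re) := by
        rw [← Real.rpow_add_one ht0.ne']
        simp
  rw [integral_const_mul, integral_Ioi_rpow_of_lt (by linarith) hx0] at hint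
  rw [psiRemainder_eq_neg_integral_Ioi hx hs1, norm_mul, norm_neg, norm_mul,
    norm_cpow_eq_rpow_re_of_pos hx0]
  have hxs : x ^ (s - 1).re * x ^ (-s.re + 1) = 1 := by
    rw [← Real.rpow_add hx0]; simp
  have hL : 0 ≤ Real.log x := Real.log_nonneg hx
  calc x ^ (s - 1).re * (‖s‖ * ‖∫ t in Ioi x, (psiError t : ℂ) * (t : ℂ) ^ (-(s + 1))‖)
      ≤ x ^ (s - 1).re * (2 * (C * q * (-x ^ (-s.re + 1) / (-s.re + 1)))) := by gcongr
    _ = 2 * C * q * (1 / (s.re - 1)) * (x ^ (s - 1).re * x ^ (-s.re + 1)) := by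
        rw [← neg_sub, show -s.re + 1 = -(s.re - 1) by ring]
        rw [neg_div_neg_eq]
        ring
    _ ≤ 2 * C * q * Real.log x := by
        rw [hxs, mul_one]
        gcongr
        rw [div_le_iff₀ hs1']
        linarith
    _ = _ := by ring

theorem exists_norm_one_add_logDeriv_riemannZeta₁_le : ∃ G : ℝ, 0 < G ∧ ∀ s : ℂ, ‖s - 1‖ ≤ 1 / 5 →
    ‖1 + deriv riemannZeta₁ s / riemannZeta₁ s‖ ≤ G := by
  have hcont : ContinuousOn (fun s ↦ 1 + deriv riemannZeta₁ s / riemannZeta₁ s)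
      (closedBall 1 (1 / 5)) := by
    refine continuousOn_const.add (ContinuousOn.div ?_ ?_ fun s hs ↦
      riemannZeta₁_ne_zero_of_norm_sub_one_le (by simpa [dist_eq_norm] using hs))
    · exact (differentiable_riemannZeta₁.contDiff.continuous_deriv le_rfl).continuousOn
    · exact differentiable_riemannZeta₁.continuous.continuousOn
  obtain ⟨G, hG⟩ := (isCompact_closedBall (1 : ℂ) (1 / 5)).exists_bound_of_continuousOn hcont
  exact ⟨max G 1, by positivity, fun s hs ↦
    (hG s (by simpa [dist_eq_norm] using hs)).trans (le_max_left _ _)⟩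

theorem differentiableAt_cpow_mul_psiRemainder {x : ℝ} (hx : 1 ≤ x) {s : ℂ}
    (hs : ‖s - 1‖ ≤ 1 / 5) :
    DifferentiableAt ℂ (fun s ↦ (x : ℂ) ^ (s - 1) * psiRemainder x s) s := by
  have hx0 : (x : ℂ) ≠ 0 := ofReal_ne_zero.2 (by linarith)
  refine ((differentiableAt_id.sub_const 1).const_cpow (Or.inl hx0)).mul ?_
  refine ((differentiableAt_id.mul (differentiable_integral_psiError_mul_cpow hx s)).add_const
    1).add ?_
  exact (differentiable_riemannZeta₁.contDiff.differentiable_deriv_two s).div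
    (differentiable_riemannZeta₁ s) (riemannZeta₁_ne_zero_of_norm_sub_one_le hs)

theorem norm_le_of_rectangle_bounds {f : ℂ → ℂ} {a b h A B v : ℝ} (hab : a < b) (hh : 0 < h)
    (hv : 0 ≤ v) (hf : ∀ z : ℂ, a ≤ z.re → z.re ≤ b → |z.im| ≤ h → DifferentiableAt ℂ f z)
    (hA : ∀ z : ℂ, (z.re = a ∨ z.re = b) → |z.im| ≤ h → ‖f z‖ ≤ A)
    (hB : ∀ z : ℂ, a ≤ z.re → z.re ≤ b → |z.im| = h → ‖f z‖ ≤ B)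
    {s : ℂ} (hsa : a ≤ s.re) (hsb : s.re ≤ b) (hsh : |s.im| ≤ h) :
    ‖f s‖ ≤ Real.exp (v * (b - a) ^ 2) * (A + B * Real.exp (-v * (h - |s.im|) ^ 2)) := by
  have hA0 : 0 ≤ A := (norm_nonneg _).trans (hA ⟨a, 0⟩ (Or.inl rfl) (by simpa using hh.le))
  have hB0 : 0 ≤ B := (norm_nonneg _).trans (hB ⟨a, h⟩ le_rfl hab.le (abs_of_pos hh))
  set U : Set ℂ := Ioo a b ×ℂ Ioo (-h) h with hU
  have hcl : closure U = Icc a b ×ℂ Icc (-h) h := by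
    rw [hU, closure_reProdIm, closure_Ioo hab.ne, closure_Ioo (by linarith)]
  have hclm : ∀ z ∈ closure U, a ≤ z.re ∧ z.re ≤ b ∧ |z.im| ≤ h := by
    intro z hz
    rw [hcl, mem_reProdIm] at hz
    exact ⟨hz.1.1, hz.1.2, abs_le.2 hz.2⟩
  have hw : ∀ z : ℂ, ‖cexp (v * (z - s) ^ 2)‖ =
      Real.exp (v * (z.re - s.re) ^ 2) * Real.exp (-v * (z.im - s.im) ^ 2) := by
    intro z
    rw [norm_exp, ← Real.exp_add, sq, re_ofReal_mul, mul_re, sub_re, sub_im]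
    ring_nf
  have hre : ∀ z ∈ closure U, Real.exp (v * (z.re - s.re) ^ 2) ≤ Real.exp (v * (b - a) ^ 2) := by
    intro z hz
    obtain ⟨h1, h2, -⟩ := hclm z hz
    apply Real.exp_le_exp.2
    refine mul_le_mul_of_nonneg_left ?_ hv
    exact sq_le_sq' (by linarith) (by linarith)
  have key := Complex.norm_le_of_forall_mem_frontier_norm_le (U := U)
    (f := fun z ↦ cexp (v * (z - s) ^ 2) * f z)
    (C := Real.exp (v * (b - a) ^ 2) * (A + B * Real.exp (-v * (h - |s.im|) ^ 2)))
    ((isBounded_Ioo a b).reProdIm (isBounded_Ioo (-h) h))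
    (DifferentiableOn.diffContOnCl fun z hz ↦ by
      obtain ⟨h1, h2, h3⟩ := hclm z hz
      exact ((by fun_prop : DifferentiableAt ℂ (fun z ↦ cexp (v * (z - s) ^ 2)) z).mul
        (hf z h1 h2 h3)).differentiableWithinAt)
    (fun z hz ↦ ?_) (z := s) (by
      rw [hcl, mem_reProdIm]
      exact ⟨⟨hsa, hsb⟩, abs_le.1 hsh⟩)
  · simpa using key
  · have hzc : z ∈ closure U := frontier_subset_closure hz
    obtain ⟨h1, h2, h3⟩ := hclm z hzc
    rw [norm_mul, hw, mul_assoc]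
    refine mul_le_mul (hre z hzc) ?_ (by positivity) (by positivity)
    rw [hU, frontier_reProdIm, frontier_Ioo hab, frontier_Ioo (by linarith)] at hz
    rcases hz with hz | hz
    · have him : |z.im| = h := by
        rcases hz.2 with h | h
        · rw [h, abs_neg, abs_of_pos hh]
        · rw [mem_singleton_iff.1 h, abs_of_pos hh]
      have h4 : h - |s.im| ≤ |z.im - s.im| := him ▸ abs_sub_abs_le_abs_sub z.im s.im
      have h5 : (h - |s.im|) ^ 2 ≤ (z.im - s.im) ^ 2 := by
        rw [← sq_abs (z.im - s.im)]
        exact pow_le_pow_left₀ (by linarith) h4 2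
      calc Real.exp (-v * (z.im - s.im) ^ 2) * ‖f z‖
          ≤ Real.exp (-v * (h - |s.im|) ^ 2) * B := by
            gcongr ?_ * ?_
            · exact Real.exp_le_exp.2 (by nlinarith)
            · exact hB z h1 h2 him
        _ ≤ _ := by linarith
    · have h4 : Real.exp (-v * (z.im - s.im) ^ 2) ≤ 1 :=
        Real.exp_le_one_iff.2 (by nlinarith [sq_nonneg (z.im - s.im)])
      have h5 := hA z (by simpa using hz.1) h3
      calc Real.exp (-v * (z.im - s.im) ^ 2) * ‖f z‖ ≤ 1 * A := by gcongr
        _ ≤ _ := by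
          have : 0 ≤ B * Real.exp (-v * (h - |s.im|) ^ 2) := by positivity
          linarith

theorem norm_sub_one_le_one_fifth {z : ℂ} (h1 : |z.re - 1| ≤ 1 / 10) (h2 : |z.im| ≤ 3 / 20) :
    ‖z - 1‖ ≤ 1 / 5 := by
  rw [Complex.norm_eq_sqrt_sq_add_sq, Real.sqrt_le_left (by norm_num), sub_re, sub_im, one_re,
    one_im, sub_zero, ← sq_abs, ← sq_abs z.im]
  nlinarith [abs_nonneg (z.re - 1), abs_nonneg z.im]

theorem norm_le_two_of_norm_sub_one_le {z : ℂ} (h : ‖z - 1‖ ≤ 1 / 5) : ‖z‖ ≤ 2 := by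
  have := norm_add_le (z - 1) 1
  rw [sub_add_cancel, norm_one] at this
  linarith

theorem norm_cpow_mul_psiRemainder_le_near {c C x G : ℝ} (hc : 0 < c) (hc1 : c ≤ 1) (hC : 0 ≤ C)
    (hE : ∀ t : ℝ, 1 ≤ t → |psiError t| ≤ C * t * Real.exp (-c * √(Real.log t)))
    (hG : ∀ s : ℂ, ‖s - 1‖ ≤ 1 / 5 → ‖1 + deriv riemannZeta₁ s / riemannZeta₁ s‖ ≤ G)
    (hx : 1 ≤ x) (hu : 10 ≤ √(Real.log x)) {s : ℂ}
    (hs1 : 1 - c / √(Real.log x) ≤ s.re) (hs2 : s.re ≤ 1 + 1 / Real.log x)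
    (hs3 : |s.im| ≤ 1 / 10) :
    ‖(x : ℂ) ^ (s - 1) * psiRemainder x s‖ ≤
      Real.exp 4 * (2 * C + G + Real.exp 100 * (12 * Real.exp 1 + Real.exp 1 * G)) *
        (Real.log x * Real.exp (-c * √(Real.log x))) := by
  have hx0 : 0 < x := by linarith
  have hG0 : 0 ≤ G := (norm_nonneg _).trans (hG 1 (by simp))
  set u := √(Real.log x) with hudef
  have hu0 : 0 < u := by linarith
  have hu2 : u ^ 2 = Real.log x := Real.sq_sqrt (Real.log_nonneg hx)
  rw [← hu2] at hs2 ⊢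
  set q := Real.exp (-c * u) with hq
  have hq0 : 0 < q := Real.exp_pos _
  have hcu : c / u ≤ 1 / 10 := by gcongr
  have hcu0 : 0 < c / u := by positivity
  have hu1 : 1 / u ^ 2 ≤ 1 / 10 := by gcongr; nlinarith
  have hu10 : 0 < 1 / u ^ 2 := by positivity
  have hball : ∀ z : ℂ, 1 - c / u ≤ z.re → z.re ≤ 1 + 1 / u ^ 2 → |z.im| ≤ 3 / 20 →
      ‖z - 1‖ ≤ 1 / 5 := fun z h1 h2 h3 ↦
    norm_sub_one_le_one_fifth (abs_le.2 ⟨by linarith, by linarith⟩) h3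
  have key := norm_le_of_rectangle_bounds (f := fun s ↦ (x : ℂ) ^ (s - 1) * psiRemainder x s)
    (a := 1 - c / u) (b := 1 + 1 / u ^ 2) (h := 3 / 20) (v := u ^ 2)
    (A := (2 * C * u ^ 2 + G) * q)
    (B := 2 * (6 * Real.exp 1) * u ^ 2 + Real.exp 1 * G) (s := s)
    (by linarith) (by norm_num) (by positivity)
    (fun z h1 h2 h3 ↦ differentiableAt_cpow_mul_psiRemainder hx (hball z h1 h2 h3)) ?_ ?_
    hs1 hs2 (by linarith)
  · refine key.trans ?_
    have e1 : Real.exp (u ^ 2 * (1 + 1 / u ^ 2 - (1 - c / u)) ^ 2) ≤ Real.exp 4 := by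
      apply Real.exp_le_exp.2
      have h1 : 1 / u ^ 2 ≤ 1 / u := by gcongr; nlinarith
      have h2 : c / u ≤ 1 / u := by gcongr
      have h3 : 1 + 1 / u ^ 2 - (1 - c / u) ≤ 2 / u := by
        rw [show 2 / u = 1 / u + 1 / u by ring]; linarith
      calc u ^ 2 * (1 + 1 / u ^ 2 - (1 - c / u)) ^ 2 ≤ u ^ 2 * (2 / u) ^ 2 := by
            gcongr
            linarith
        _ = 4 := by field_simp; norm_num
    have e2 : Real.exp (-u ^ 2 * (3 / 20 - |s.im|) ^ 2) ≤ Real.exp 100 * q := by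
      rw [hq, ← Real.exp_add]
      apply Real.exp_le_exp.2
      have h1 : (1 / 20 : ℝ) ^ 2 ≤ (3 / 20 - |s.im|) ^ 2 :=
        pow_le_pow_left₀ (by norm_num) (by linarith) 2
      have h2 := mul_le_mul_of_nonneg_left h1 (sq_nonneg u)
      nlinarith [sq_nonneg (u / 20 - 10)]
    have e3 : G ≤ G * u ^ 2 := le_mul_of_one_le_right hG0 (by nlinarith)
    have e4 : Real.exp 1 * G ≤ Real.exp 1 * G * u ^ 2 :=
      le_mul_of_one_le_right (by positivity) (by nlinarith)
    calc _ ≤ Real.exp 4 * ((2 * C * u ^ 2 + G * u ^ 2) * q +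
          (2 * (6 * Real.exp 1) * u ^ 2 + Real.exp 1 * G * u ^ 2) * (Real.exp 100 * q)) := by
          gcongr
      _ = _ := by ring
  · rintro z (hz | hz) him
    · have hb := hball z hz.ge (by linarith) him
      have := norm_cpow_mul_psiRemainder_le_left hc hC hE hx
        (norm_le_two_of_norm_sub_one_le hb) (hG z hb)
        (by rw [hz, ← hudef]; field_simp; linarith)
      rwa [← hudef, ← hu2] at this
    · have hb := hball z (by linarith) hz.le him
      have := norm_cpow_mul_psiRemainder_le_right hc.le hC hE hx
        (norm_le_two_of_norm_sub_one_le hb) (by linarith)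
        (by rw [hz, ← hu2]; field_simp; linarith)
      rw [← hudef, ← hu2] at this
      refine this.trans ?_
      gcongr
      linarith
  · intro z h1 h2 h3
    have hb := hball z h1 h2 h3.le
    have := norm_cpow_mul_psiRemainder_le_trivial (Q := Real.exp 1) hx
      (norm_le_two_of_norm_sub_one_le hb) (hG z hb) (Real.one_le_exp zero_le_one) (by
        rw [Real.rpow_def_of_pos hx0, ← hu2]
        apply Real.exp_le_exp.2
        calc u ^ 2 * (z.re - 1) ≤ u ^ 2 * (1 / u ^ 2) := by gcongr; linarith
          _ = 1 := by field_simp)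
    rwa [← hu2] at this

theorem exists_norm_cpow_mul_psiRemainder_le : ∃ c C : ℝ, 0 < c ∧ 0 < C ∧ ∀ x : ℝ, 1 ≤ x →
    ∀ s : ℂ, ‖s - 1‖ ≤ 1 / 10 →
      ‖(x : ℂ) ^ (s - 1) * psiRemainder x s‖ ≤ C * Real.exp (-c * √(Real.log x)) ∧
      |psiError x| ≤ C * x * Real.exp (-c * √(Real.log x)) := by
  obtain ⟨c, C, hc, hc1, hC, hE⟩ := exists_abs_psiError_le
  obtain ⟨G, hG0, hG⟩ := exists_norm_one_add_logDeriv_riemannZeta₁_le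
  set K := Real.exp 4 * (2 * C + G + Real.exp 100 * (12 * Real.exp 1 + Real.exp 1 * G)) with hK
  have hK1 : 2 * C + G ≤ K := by
    have h1 : 0 ≤ Real.exp 100 * (12 * Real.exp 1 + Real.exp 1 * G) := by positivity
    rw [hK]
    nlinarith [Real.one_le_exp (show (0 : ℝ) ≤ 4 by norm_num)]
  have hK0 : 0 < K := by positivity
  set M := (2 * (6 * Real.exp 10) * 100 + Real.exp 10 * G) * Real.exp 10 with hM
  have hM0 : 0 < M := by positivity
  refine ⟨c / 2, K * (8 / c ^ 2) + M + C, by positivity, by positivity, fun x hx s hs ↦ ?_⟩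
  have hx0 : 0 < x := by linarith
  have hs' : ‖s - 1‖ ≤ 1 / 5 := by linarith
  have hs2 := norm_le_two_of_norm_sub_one_le hs'
  have hre : |s.re - 1| ≤ 1 / 10 := by simpa using (abs_re_le_norm (s - 1)).trans hs
  have him : |s.im| ≤ 1 / 10 := by simpa using (abs_im_le_norm (s - 1)).trans hs
  set u := √(Real.log x) with hudef
  have hu0 : 0 ≤ u := Real.sqrt_nonneg _
  have hu2 : u ^ 2 = Real.log x := Real.sq_sqrt (Real.log_nonneg hx)
  set q := Real.exp (-(c / 2) * u) with hq
  have hq0 : 0 < q := Real.exp_pos _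
  have hKq0 : 0 ≤ K * (8 / c ^ 2) * q := by positivity
  have hMq0 : 0 ≤ M * q := by positivity
  have hCq0 : 0 ≤ C * q := by positivity
  constructor
  · rcases lt_or_ge u 10 with hu | hu
    · have h1 := norm_cpow_mul_psiRemainder_le_trivial (Q := Real.exp 10) hx hs2 (hG s hs')
        (Real.one_le_exp (by norm_num)) (by
          rw [Real.rpow_def_of_pos hx0, ← hu2]
          apply Real.exp_le_exp.2
          nlinarith [abs_le.1 hre, sq_nonneg u])
      have h2 : 1 ≤ Real.exp 10 * q := by
        rw [hq, ← Real.exp_add]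
        exact Real.one_le_exp (by nlinarith)
      have h3 : Real.log x ≤ 100 := by rw [← hu2]; nlinarith
      calc _ ≤ _ := h1
        _ ≤ (2 * (6 * Real.exp 10) * 100 + Real.exp 10 * G) * (Real.exp 10 * q) := by
          refine le_trans ?_ (le_mul_of_one_le_right (by positivity) h2)
          gcongr
        _ = M * q := by rw [hM]; ring
        _ ≤ _ := by linarith
    · have hmain : ‖(x : ℂ) ^ (s - 1) * psiRemainder x s‖ ≤
          K * (u ^ 2 * Real.exp (-c * u)) := by
        have h1 : 1 ≤ u ^ 2 := by nlinarith
        have hpos : 0 ≤ u ^ 2 * Real.exp (-c * u) := by positivity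
        have hle : (2 * C * u ^ 2 + G) * Real.exp (-c * u) ≤ K * (u ^ 2 * Real.exp (-c * u)) :=
          calc (2 * C * u ^ 2 + G) * Real.exp (-c * u)
              ≤ (2 * C * u ^ 2 + G * u ^ 2) * Real.exp (-c * u) := by
                gcongr
                exact le_mul_of_one_le_right hG0.le h1
            _ = (2 * C + G) * (u ^ 2 * Real.exp (-c * u)) := by ring
            _ ≤ _ := by gcongr
        have hu00 : 0 < u := by linarith
        rcases le_or_gt s.re (1 - c / u) with hl | hl
        · have := norm_cpow_mul_psiRemainder_le_left hc hC.le hE hx hs2 (hG s hs')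
            (by
              rw [← hudef]
              have : c / u ≤ 1 - s.re := by linarith
              rwa [div_le_iff₀ hu00] at this)
          rw [← hudef, ← hu2] at this
          exact this.trans hle
        rcases le_or_gt s.re (1 + 1 / u ^ 2) with hr | hr
        · have := norm_cpow_mul_psiRemainder_le_near hc hc1 hC.le hE hG hx hu hl.le
            (by rwa [← hu2]) him
          rwa [← hudef, ← hu2] at this
        · have hpos' : 0 < 1 / u ^ 2 := by positivity
          have := norm_cpow_mul_psiRemainder_le_right hc.le hC.le hE hx hs2 (by linarith)
            (by
              have : 1 / u ^ 2 ≤ s.re - 1 := by linarith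
              rwa [div_le_iff₀ (by positivity), hu2] at this)
          rw [← hudef, ← hu2] at this
          refine (this.trans ?_).trans hle
          gcongr
          linarith
      calc _ ≤ _ := hmain
        _ ≤ K * (8 / c ^ 2 * q) :=
          mul_le_mul_of_nonneg_left (sq_mul_exp_neg_le hc hu0) hK0.le
        _ ≤ _ := by linarith
  · calc |psiError x| ≤ C * x * Real.exp (-c * u) := hE x hx
      _ ≤ C * x * q := by rw [hq]; gcongr; linarith
      _ ≤ _ := by gcongr; have : 0 ≤ K * (8 / c ^ 2) := by positivity
                  linarith

end

open Complex Finset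

/-- Unconditional explicit-formula approximation: for `x ≥ 2` and `0 < |s − 1| < 1/10`,
`∑_{n ≤ x} Λ(n)/n^s = x^{1−s}/(1−s) − (ζ'/ζ)(s) + O(x^{1−Re s} exp(−c √(log x)))`. -/
theorem chebyshev_sum_approx :
    ∃ c C : ℝ, 0 < c ∧ 0 < C ∧
      ∀ x : ℝ, 2 ≤ x → ∀ s : ℂ, 0 < ‖s - 1‖ → ‖s - 1‖ < 1 / 10 →
        ‖(∑ n ∈ Finset.Icc 1 ⌊x⌋₊,
              (ArithmeticFunction.vonMangoldt n : ℂ) / (n : ℂ) ^ s) -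
            (x : ℂ) ^ ((1 : ℂ) - s) / (1 - s) +
            deriv riemannZeta s / riemannZeta s‖ ≤
          C * x ^ (1 - s.re) * Real.exp (-c * Real.sqrt (Real.log x)) := by
  obtain ⟨c, C, hc, hC, h⟩ := exists_norm_cpow_mul_psiRemainder_le
  refine ⟨c, 2 * C, hc, by positivity, fun x hx s hs0 hs ↦ ?_⟩
  obtain ⟨h1, h2⟩ := h x (by linarith) s hs.le
  have hx0 : 0 < x := by linarith
  have hxC : (x : ℂ) ≠ 0 := ofReal_ne_zero.2 hx0.ne'
  have hsne : s ≠ 0 := by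
    rintro rfl
    norm_num at hs
  rw [sum_vonMangoldt_div_cpow_sub_add_eq (by linarith) hsne
    (sub_ne_zero.1 (norm_pos_iff.1 hs0)) (riemannZeta₁_ne_zero_of_norm_sub_one_le (by linarith))]
  have e : (psiError x : ℂ) * (x : ℂ) ^ (-s) + psiRemainder x s =
      (x : ℂ) ^ (1 - s) * ((psiError x : ℂ) / x + (x : ℂ) ^ (s - 1) * psiRemainder x s) := by
    rw [mul_add, ← mul_assoc, ← cpow_add _ _ hxC]
    have h0 : (1 - s) + (s - 1) = 0 := by ring
    rw [h0, cpow_zero, one_mul, sub_eq_add_neg 1 s, cpow_add _ _ hxC, cpow_one]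
    field_simp
  rw [e, norm_mul, norm_cpow_eq_rpow_re_of_pos hx0, sub_re, one_re]
  have h3 : ‖(psiError x : ℂ) / x‖ ≤ C * Real.exp (-c * √(Real.log x)) := by
    rw [norm_div, norm_real, norm_real, Real.norm_eq_abs, Real.norm_of_nonneg hx0.le,
      div_le_iff₀ hx0]
    linarith
  calc x ^ (1 - s.re) * ‖(psiError x : ℂ) / x + (x : ℂ) ^ (s - 1) * psiRemainder x s‖
      ≤ x ^ (1 - s.re) * (C * Real.exp (-c * √(Real.log x)) +
          C * Real.exp (-c * √(Real.log x))) := by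
        gcongr
        exact (norm_add_le _ _).trans (add_le_add h3 h1)
    _ = _ := by ring
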